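/- arXiv:1602.06443 — 2 statements merged into one kernel-verified Lean document; each statement's English description precedes it below -/
import Mathlib

section
/- Suppose that (i) the sequence of pairs (d_n, λ_n)_{n∈ℤ} is stationary and ergodic under P, (ii) E_P(log ξ_0) exists in [−∞, +∞] (at least one of the positive or negative parts of log ξ_0 is P-integrable), and (iii) E_P(log d_0) < ∞. Then: (a) if E_P(log ξ_0) < 0, then lim_{n→∞} X_n = +∞ ℙ-almost surely; (b) if E_P(log ξ_0) > 0, then lim_{n→∞} X_n = −∞ ℙ-almost surely; (c) if E_P(log ξ_0) = 0, then liminf_{n→∞} X_n = −∞ and limsup_{n→∞} X_n = +∞ ℙ-almost surely. -/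
open MeasureTheory ProbabilityTheory Filter Set
open scoped ENNReal NNReal Topology

noncomputable section

/-- One-step transition probability of the nearest-neighbour walk in environment `env`:
probability `env i` of a step from `i` to `i+1`, probability `1 - env i` of a step
from `i` to `i-1`. -/
def stepProb (env : ℤ → ℝ) (i j : ℤ) : ℝ :=
  if j = i + 1 then env i else if j = i - 1 then 1 - env i else 0

/-- `IsQuenchedRW env x μ` says that `μ` is the quenched law `P_{x,ω}` of the random walk
in the environment `env` started at `x`: a probability measure on trajectories whose
cylinder probabilities are products of the one-step transition probabilities. -/
def IsQuenchedRW (env : ℤ → ℝ) (x : ℤ) (μ : Measure (ℕ → ℤ)) : Prop :=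
  IsProbabilityMeasure μ ∧
  ∀ (n : ℕ) (path : ℕ → ℤ), path 0 = x →
    μ {f | ∀ k ≤ n, f k = path k}
      = ENNReal.ofReal (∏ k ∈ Finset.range n, stepProb env (path k) (path (k + 1)))

/-- The sparse environment: `lam k` at the marked site `a k`, and `1/2` elsewhere. -/
def sparseEnv (lam : ℤ → ℝ) (a : ℤ → ℤ) (n : ℤ) : ℝ :=
  haveI := Classical.propDecidable (∃ k, a k = n)
  if h : ∃ k, a k = n then lam h.choose else 1 / 2

section ErgodicPart

variable {E : Type*} [MeasurableSpace E] {μ : Measure E} {T : E → E} {Y : E → ℝ}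

/-- running maxima of the Birkhoff sums, defined recursively. -/
def runMax (T : E → E) (Y : E → ℝ) : ℕ → E → ℝ
  | 0 => fun _ => 0
  | (n + 1) => fun x => max 0 (Y x + runMax T Y n (T x))

lemma runMax_nonneg (n : ℕ) (x : E) : 0 ≤ runMax T Y n x := by
  cases n with
  | zero => simp [runMax]
  | succ n => simp [runMax]

lemma runMax_succ (n : ℕ) (x : E) :
    runMax T Y (n + 1) x = max 0 (Y x + runMax T Y n (T x)) := rfl

lemma runMax_mono_succ (n : ℕ) (x : E) : runMax T Y n x ≤ runMax T Y (n + 1) x := by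
  induction n generalizing x with
  | zero => exact runMax_nonneg 1 x
  | succ n ih =>
    rw [runMax_succ, runMax_succ (n + 1)]
    have := ih (T x)
    gcongr

lemma runMax_mono (x : E) : Monotone (fun n => runMax T Y n x) :=
  monotone_nat_of_le_succ fun n => runMax_mono_succ n x

lemma birkhoff_le_runMax (n : ℕ) (x : E) : birkhoffSum T Y n x ≤ runMax T Y n x := by
  induction n generalizing x with
  | zero => simp [runMax]
  | succ n ih =>
    rw [birkhoffSum_succ', runMax_succ]
    exact le_max_of_le_right (by linarith [ih (T x)])

lemma runMax_eq (n : ℕ) (x : E) : ∃ k ≤ n, runMax T Y n x = birkhoffSum T Y k x := by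
  induction n generalizing x with
  | zero => exact ⟨0, le_rfl, by simp [runMax]⟩
  | succ n ih =>
    rw [runMax_succ]
    rcases max_choice 0 (Y x + runMax T Y n (T x)) with h | h
    · exact ⟨0, by omega, by rw [h]; simp⟩
    · obtain ⟨k, hk, hk'⟩ := ih (T x)
      exact ⟨k + 1, by omega, by rw [h, hk', birkhoffSum_succ']⟩

lemma runMax_measurable (hT : Measurable T) (hY : Measurable Y) (n : ℕ) :
    Measurable (runMax T Y n) := by
  induction n with
  | zero => exact measurable_const
  | succ n ih => exact measurable_const.max (hY.add (ih.comp hT))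

lemma runMax_integrable [IsFiniteMeasure μ] (hT : MeasurePreserving T μ μ) (hY : Integrable Y μ)
    (n : ℕ) : Integrable (runMax T Y n) μ := by
  induction n with
  | zero => exact integrable_const 0
  | succ n ih =>
    have h1 : Integrable (fun x => Y x + runMax T Y n (T x)) μ :=
      hY.add (hT.integrable_comp_of_integrable ih)
    exact (integrable_const (0 : ℝ)).sup h1

lemma bdd_shift (x : E) : BddAbove (range fun n => runMax T Y n (T x)) ↔
    BddAbove (range fun n => runMax T Y n x) := by
  constructor
  · rintro ⟨C, hC⟩
    refine ⟨max 0 (Y x + C), ?_⟩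
    rintro _ ⟨n, rfl⟩
    cases n with
    | zero => simp [runMax]
    | succ n =>
      have := hC ⟨n, rfl⟩
      simp only [runMax_succ] at this ⊢
      gcongr
  · rintro ⟨C, hC⟩
    refine ⟨C - Y x, ?_⟩
    rintro _ ⟨n, rfl⟩
    have h1 := hC ⟨n + 1, rfl⟩
    simp only [runMax_succ] at h1
    have := (le_max_right _ _).trans h1
    simp only
    linarith

/-- If the mean is negative, the Birkhoff sums are a.s. bounded above. -/
lemma ae_bdd_of_neg [IsProbabilityMeasure μ] (hT : Ergodic T μ) (hYm : Measurable Y)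
    (hY : Integrable Y μ) (hneg : ∫ x, Y x ∂μ < 0) :
    ∀ᵐ x ∂μ, BddAbove (range fun n => runMax T Y n x) := by
  have hTm := hT.measurable
  set B : Set E := {x | BddAbove (range fun n => runMax T Y n x)} with hB
  have hBm : MeasurableSet B := measurableSet_bddAbove_range (fun n => runMax_measurable hTm hYm n)
  have hinv : T ⁻¹' B = B := by
    ext x; exact bdd_shift x
  rcases hT.toPreErgodic.ae_empty_or_univ hBm hinv with h | h
  swap
  · filter_upwards [h.mem_iff] with x hx using hx.2 trivial
  exfalso
  have hun : ∀ᵐ x ∂μ, ¬ BddAbove (range fun n => runMax T Y n x) := by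
    filter_upwards [h.mem_iff] with x hx h'
    exact hx.1 h'
  have hun' := hT.toMeasurePreserving.quasiMeasurePreserving.ae hun
  -- g n
  have hlim : Tendsto (fun n => ∫ x, (runMax T Y (n + 1) x - Y x - runMax T Y n (T x)) ∂μ) atTop
      (𝓝 (∫ x, (0 : ℝ) ∂μ)) := by
    refine tendsto_integral_of_dominated_convergence (fun x => |Y x|) ?_ hY.abs ?_ ?_
    · intro n
      exact (((runMax_measurable hTm hYm _).sub hYm).sub
        ((runMax_measurable hTm hYm n).comp hTm)).aestronglyMeasurable
    · intro n
      refine Eventually.of_forall fun x => ?_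
      have h0 := runMax_nonneg (T := T) (Y := Y) n (T x)
      rw [runMax_succ, Real.norm_eq_abs]
      rcases max_cases 0 (Y x + runMax T Y n (T x)) with ⟨h1, h2⟩ | ⟨h1, h2⟩ <;> rw [h1]
      · rw [abs_of_nonneg (by linarith)]
        linarith [neg_abs_le (Y x)]
      · simp
    · filter_upwards [hun'] with x hx
      have htop := tendsto_atTop_atTop_of_monotone' (runMax_mono (T := T) (Y := Y) (T x)) hx
      refine tendsto_const_nhds.congr' ?_
      filter_upwards [htop.eventually_ge_atTop (- Y x)] with n hn
      rw [runMax_succ, max_eq_right (by linarith)]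
      ring
  have hge : ∀ n, - ∫ x, Y x ∂μ ≤ ∫ x, (runMax T Y (n + 1) x - Y x - runMax T Y n (T x)) ∂μ := by
    intro n
    have i1 := runMax_integrable hT.toMeasurePreserving hY (n + 1)
    have i2 := runMax_integrable hT.toMeasurePreserving hY n
    have i3 : Integrable (fun x => runMax T Y n (T x)) μ :=
      hT.toMeasurePreserving.integrable_comp_of_integrable i2
    have i4 : Integrable (fun x => runMax T Y (n + 1) x - Y x) μ := i1.sub hY
    rw [integral_sub i4 i3, integral_sub i1 hY]
    have e : ∫ x, runMax T Y n (T x) ∂μ = ∫ x, runMax T Y n x ∂μ := by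
      have := integral_map (μ := μ) hTm.aemeasurable (f := runMax T Y n)
        (runMax_measurable hTm hYm n).aestronglyMeasurable
      rw [hT.toMeasurePreserving.map_eq] at this
      exact this.symm
    have := integral_mono i2 i1 (fun x => runMax_mono_succ n x)
    linarith
  have := ge_of_tendsto' hlim hge
  simp at this
  linarith

lemma ae_not_atBot [IsProbabilityMeasure μ] (hT : Ergodic T μ) (hYm : Measurable Y)
    (hY : Integrable Y μ) (hzero : ∫ x, Y x ∂μ = 0) :
    ∀ᵐ x ∂μ, ¬ Tendsto (fun n => birkhoffSum T Y n x) atTop atBot := by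
  have hTm := hT.measurable
  have hSm : ∀ n, Measurable (birkhoffSum T Y n) := fun n => by
    unfold birkhoffSum
    exact Finset.measurable_sum _ fun k _ => hYm.comp (hTm.iterate k)
  set B : Set E := {x | Tendsto (fun n => birkhoffSum T Y n x) atTop atBot} with hB
  have hBm : MeasurableSet B := measurableSet_tendsto atBot hSm
  have hinv : T ⁻¹' B = B := by
    ext x
    simp only [hB, mem_preimage, mem_ofPred_eq]
    rw [← tendsto_add_atTop_iff_nat (f := fun n => birkhoffSum T Y n x) 1]
    simp only [birkhoffSum_succ']
    constructor
    · intro h; exact tendsto_atBot_add_const_left _ _ h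
    · intro h
      have := tendsto_atBot_add_const_left _ (- Y x) h
      simpa using this
  rcases hT.toPreErgodic.ae_empty_or_univ hBm hinv with h | h
  · filter_upwards [h.mem_iff] with x hx using hx.1
  exfalso
  have hbot : ∀ᵐ x ∂μ, Tendsto (fun n => birkhoffSum T Y n x) atTop atBot := by
    filter_upwards [h.mem_iff] with x hx using hx.2 trivial
  have hbdd : ∀ᵐ x ∂μ, BddAbove (range fun n => runMax T Y n x) := by
    filter_upwards [hbot] with x hx
    obtain ⟨C, hC⟩ := bddAbove_range_of_tendsto_atTop_atBot hx
    refine ⟨C, ?_⟩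
    rintro _ ⟨n, rfl⟩
    obtain ⟨k, -, hk⟩ := runMax_eq (T := T) (Y := Y) n x
    simp only [hk]
    exact hC ⟨k, rfl⟩
  set M : E → ℝ := fun x => ⨆ n, runMax T Y n x with hM
  have hMm : Measurable M := Measurable.iSup fun n => runMax_measurable hTm hYm n
  have hM0 : ∀ x, 0 ≤ M x := fun x => Real.iSup_nonneg fun n => runMax_nonneg n x
  have hqmp := hT.toMeasurePreserving.quasiMeasurePreserving
  have hrec : ∀ᵐ x ∂μ, M x = max 0 (Y x + M (T x)) := by
    filter_upwards [hbdd, hqmp.ae hbdd] with x h1 h2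
    have t1 := tendsto_atTop_ciSup (runMax_mono (T := T) (Y := Y) x) h1
    have t2 := tendsto_atTop_ciSup (runMax_mono (T := T) (Y := Y) (T x)) h2
    have t3 : Tendsto (fun n => runMax T Y (n + 1) x) atTop (𝓝 (max 0 (Y x + M (T x)))) :=
      tendsto_const_nhds.max (t2.const_add (Y x))
    exact tendsto_nhds_unique ((tendsto_add_atTop_iff_nat 1).2 t1) t3
  -- f = M∘T - M is integrable with integral zero
  have hfm : Measurable (fun x => M (T x) - M x) := (hMm.comp hTm).sub hMm
  have hfb : ∀ᵐ x ∂μ, |M (T x) - M x| ≤ |Y x| := by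
    filter_upwards [hrec] with x hx
    rw [hx]
    have := hM0 (T x)
    rcases max_cases 0 (Y x + M (T x)) with ⟨h1, h2⟩ | ⟨h1, h2⟩ <;> rw [h1]
    · rw [abs_of_nonneg (by linarith)]
      linarith [neg_abs_le (Y x)]
    · simp
  have hfi : Integrable (fun x => M (T x) - M x) μ :=
    hY.mono hfm.aestronglyMeasurable (by simpa only [Real.norm_eq_abs] using hfb)
  have hf0 : ∫ x, (M (T x) - M x) ∂μ = 0 := by
    have hmin : ∀ N : ℕ, ∫ x, (min (M (T x)) N - min (M x) N) ∂μ = 0 := by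
      intro N
      have m1 : Measurable (fun x => min (M x) (N : ℝ)) := hMm.min measurable_const
      have i1 : Integrable (fun x => min (M x) (N : ℝ)) μ := by
        refine Integrable.of_bound m1.aestronglyMeasurable (N : ℝ) (Eventually.of_forall fun x => ?_)
        rw [Real.norm_eq_abs, abs_of_nonneg (le_min (hM0 x) (Nat.cast_nonneg N))]
        exact min_le_right _ _
      have i2 : Integrable (fun x => min (M (T x)) (N : ℝ)) μ :=
        hT.toMeasurePreserving.integrable_comp_of_integrable i1
      rw [integral_sub i2 i1]
      have := integral_map (μ := μ) hTm.aemeasurable (f := fun x => min (M x) (N : ℝ))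
        m1.aestronglyMeasurable
      rw [hT.toMeasurePreserving.map_eq] at this
      rw [this]; simp
    have hlim : Tendsto (fun N : ℕ => ∫ x, (min (M (T x)) N - min (M x) N) ∂μ) atTop
        (𝓝 (∫ x, (M (T x) - M x) ∂μ)) := by
      refine tendsto_integral_of_dominated_convergence (fun x => |M (T x) - M x|) ?_ hfi.abs ?_ ?_
      · intro N
        exact (((hMm.comp hTm).min measurable_const).sub
          (hMm.min measurable_const)).aestronglyMeasurable
      · intro N
        refine Eventually.of_forall fun x => ?_
        rw [Real.norm_eq_abs]
        have := abs_min_sub_min_le_max (M (T x)) N (M x) N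
        simpa using this
      · refine Eventually.of_forall fun x => ?_
        obtain ⟨N0, hN0⟩ := exists_nat_ge (max (M (T x)) (M x))
        refine tendsto_const_nhds.congr' ?_
        filter_upwards [eventually_ge_atTop N0] with N hN
        have : (N0 : ℝ) ≤ N := by exact_mod_cast hN
        rw [min_eq_left, min_eq_left]
        · linarith [le_max_right (M (T x)) (M x)]
        · linarith [le_max_left (M (T x)) (M x)]
    simp only [hmin] at hlim
    exact tendsto_nhds_unique hlim tendsto_const_nhds |>.trans rfl
  have hg0 : ∀ᵐ x ∂μ, M x - M (T x) - Y x = 0 := by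
    have hgi : Integrable (fun x => M x - M (T x) - Y x) μ := by
      have := (hfi.add hY).neg
      refine this.congr (Eventually.of_forall fun x => ?_)
      simp; ring
    have hgn : 0 ≤ᵐ[μ] fun x => M x - M (T x) - Y x := by
      filter_upwards [hrec] with x hx
      have : Y x + M (T x) ≤ M x := by rw [hx]; exact le_max_right _ _
      simp only [Pi.zero_apply]; linarith
    have hgint : ∫ x, (M x - M (T x) - Y x) ∂μ = 0 := by
      have e : (fun x => M x - M (T x) - Y x) = fun x => -(M (T x) - M x) - Y x := by
        ext x; ring
      have i5 : Integrable (fun x => -(M (T x) - M x)) μ := hfi.neg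
      rw [e, integral_sub i5 hY, integral_neg, hf0, hzero]; simp
    have := (integral_eq_zero_iff_of_nonneg_ae hgn hgi).1 hgint
    filter_upwards [this] with x hx using hx
  have hall : ∀ᵐ x ∂μ, ∀ n, M (T^[n] x) - M (T^[n + 1] x) - Y (T^[n] x) = 0 := by
    rw [ae_all_iff]
    intro n
    have := (hT.toMeasurePreserving.iterate n).quasiMeasurePreserving.ae hg0
    filter_upwards [this] with x hx
    rw [Function.iterate_succ_apply']; exact hx
  have htop : ∀ᵐ x ∂μ, Tendsto (fun n => M (T^[n] x)) atTop atTop := by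
    filter_upwards [hall, hbot] with x hx hb
    have e : ∀ n, M (T^[n] x) = M x + - birkhoffSum T Y n x := by
      intro n
      induction n with
      | zero => simp
      | succ n ih => rw [birkhoffSum_succ]; linarith [hx n]
    simp only [e]
    exact tendsto_atTop_add_const_left _ _ (tendsto_neg_atBot_atTop.comp hb)
  have hcons := hT.toMeasurePreserving.conservative
  have hC : ∀ C : ℕ, ∀ᵐ x ∂μ, ¬ (M x ≤ C) := by
    intro C
    have := hcons.ae_mem_imp_frequently_image_mem (s := {x | M x ≤ C})
      (measurableSet_le hMm measurable_const).nullMeasurableSet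
    filter_upwards [this, htop] with x h1 h2 h3
    have := h1 h3
    obtain ⟨n, hn1, hn2⟩ := (this.and_eventually (h2.eventually_gt_atTop (C : ℝ))).exists
    exact absurd hn1 (not_le.2 hn2)
  rw [← ae_all_iff] at hC
  obtain ⟨x, hx⟩ := hC.exists
  obtain ⟨N, hN⟩ := exists_nat_ge (M x)
  exact hx N hN

/-- Extended version: negative mean (possibly `-∞`) gives linear decay. -/
lemma ae_linear_decay [IsProbabilityMeasure μ] (hT : Ergodic T μ) (hYm : Measurable Y)
    (hlt : ∫⁻ x, ENNReal.ofReal (Y x) ∂μ < ∫⁻ x, ENNReal.ofReal (-Y x) ∂μ) :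
    ∃ c > 0, ∀ᵐ x ∂μ, ∃ M, ∀ n : ℕ, birkhoffSum T Y n x ≤ M - c * n := by
  -- truncation
  have hmono : ∫⁻ x, ENNReal.ofReal (-Y x) ∂μ
      = ⨆ N : ℕ, ∫⁻ x, ENNReal.ofReal (min (-Y x) N) ∂μ := by
    rw [← lintegral_iSup]
    · congr 1; ext x
      apply le_antisymm
      · obtain ⟨N, hN⟩ := exists_nat_ge (-Y x)
        refine le_iSup_of_le N ?_
        rw [min_eq_left hN]
      · exact iSup_le fun N => ENNReal.ofReal_le_ofReal (min_le_left _ _)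
    · intro N
      exact (hYm.neg.min measurable_const).ennreal_ofReal
    · intro N K hNK x
      apply ENNReal.ofReal_le_ofReal
      have : (N : ℝ) ≤ K := by exact_mod_cast hNK
      exact min_le_min le_rfl this
  rw [hmono] at hlt
  obtain ⟨N, hN⟩ := lt_iSup_iff.1 hlt
  set Z : E → ℝ := fun x => max (Y x) (-(N : ℝ)) with hZ
  have hZm : Measurable Z := hYm.max measurable_const
  have hpos : ∀ x, ENNReal.ofReal (Z x) = ENNReal.ofReal (Y x) := by
    intro x
    simp only [hZ]
    rcases le_total (Y x) (-(N : ℝ)) with h | h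
    · have : (0 : ℝ) ≤ N := Nat.cast_nonneg N
      rw [max_eq_right h, ENNReal.ofReal_of_nonpos (by linarith),
        ENNReal.ofReal_of_nonpos (by linarith)]
    · rw [max_eq_left h]
  have hneg : ∀ x, ENNReal.ofReal (-Z x) = ENNReal.ofReal (min (-Y x) N) := by
    intro x
    simp only [hZ]
    rw [← min_neg_neg, neg_neg]
  have hfin : ∫⁻ x, ENNReal.ofReal (Z x) ∂μ ≠ ⊤ := by
    simp only [hpos]; exact hN.ne_top
  have hfin' : ∫⁻ x, ENNReal.ofReal (-Z x) ∂μ ≠ ⊤ := by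
    simp only [hneg]
    refine ne_top_of_le_ne_top (b := ∫⁻ x, ENNReal.ofReal (N : ℝ) ∂μ) ?_
      (lintegral_mono fun x => ENNReal.ofReal_le_ofReal (min_le_right _ _))
    simp
  have hZi : Integrable Z μ := by
    refine ⟨hZm.aestronglyMeasurable, ?_⟩
    rw [hasFiniteIntegral_iff_norm]
    have : ∀ x, ENNReal.ofReal ‖Z x‖ ≤ ENNReal.ofReal (Z x) + ENNReal.ofReal (-Z x) := by
      intro x
      rw [Real.norm_eq_abs]
      rcases abs_cases (Z x) with ⟨h, _⟩ | ⟨h, _⟩ <;> rw [h] <;> simp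
    refine (lintegral_mono this).trans_lt ?_
    rw [lintegral_add_left hZm.ennreal_ofReal]
    exact (ENNReal.add_ne_top.2 ⟨hfin, hfin'⟩).lt_top
  have hZneg : ∫ x, Z x ∂μ < 0 := by
    rw [integral_eq_lintegral_pos_part_sub_lintegral_neg_part hZi, sub_neg]
    refine (ENNReal.toReal_lt_toReal hfin hfin').2 ?_
    simpa only [hpos, hneg] using hN
  set c : ℝ := - (∫ x, Z x ∂μ) / 2 with hc
  have hcpos : 0 < c := by rw [hc]; linarith
  refine ⟨c, hcpos, ?_⟩
  have hWi : Integrable (fun x => Z x + c) μ := hZi.add (integrable_const c)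
  have hWneg : ∫ x, (Z x + c) ∂μ < 0 := by
    rw [integral_add hZi (integrable_const c)]
    simp; linarith
  filter_upwards [ae_bdd_of_neg hT (hZm.add_const c) hWi hWneg] with x hx
  obtain ⟨M, hM⟩ := hx
  refine ⟨M, fun n => ?_⟩
  have h1 := (birkhoff_le_runMax (T := T) (Y := fun x => Z x + c) n x).trans (hM ⟨n, rfl⟩)
  have h2 : birkhoffSum T (fun x => Z x + c) n x = birkhoffSum T Z n x + c * n := by
    simp [birkhoffSum, Finset.sum_add_distrib, mul_comm]
  have h3 : birkhoffSum T Y n x ≤ birkhoffSum T Z n x :=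
    Finset.sum_le_sum fun k _ => le_max_left _ _
  linarith

/-- Sublinear growth along orbits of an integrable nonnegative function. -/
lemma ae_sublinear [IsProbabilityMeasure μ] (hT : MeasurePreserving T μ μ) (hYm : Measurable Y)
    (hfin : ∫⁻ x, ENNReal.ofReal (Y x) ∂μ ≠ ⊤) {c : ℝ} (hc : 0 < c) :
    ∀ᵐ x ∂μ, ∀ᶠ n : ℕ in atTop, Y (T^[n] x) ≤ c * n := by
  let _ : MeasureSpace E := ⟨μ⟩
  have : IsProbabilityMeasure (ℙ : Measure E) := ‹IsProbabilityMeasure μ›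
  set Z : E → ℝ := fun x => max (Y x) 0 / c with hZ
  have hZm : Measurable Z := (hYm.max measurable_const).div_const c
  have hYi : Integrable (fun x => max (Y x) 0) μ := by
    refine ⟨(hYm.max measurable_const).aestronglyMeasurable, ?_⟩
    rw [hasFiniteIntegral_iff_norm]
    refine lt_of_le_of_lt (lintegral_mono fun x => ?_) hfin.lt_top
    rw [Real.norm_eq_abs, abs_of_nonneg (le_max_right _ _)]
    rcases le_total (Y x) 0 with h | h
    · simp [max_eq_right h]
    · simp [max_eq_left h]
  have hZi : Integrable Z (ℙ : Measure E) := hYi.div_const c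
  have key := tsum_prob_mem_Ioi_lt_top hZi (fun x => by
    simp only [hZ, Pi.zero_apply]; exact div_nonneg (le_max_right _ _) hc.le)
  have key2 : ∑' j : ℕ, μ ((T^[j]) ⁻¹' {x | Z x ∈ Set.Ioi (j : ℝ)}) ≠ ⊤ := by
    have : ∀ j : ℕ, μ ((T^[j]) ⁻¹' {x | Z x ∈ Set.Ioi (j : ℝ)}) = μ {x | Z x ∈ Set.Ioi (j : ℝ)} :=
      fun j => (hT.iterate j).measure_preimage (hZm measurableSet_Ioi).nullMeasurableSet
    simp only [this]
    exact key.ne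
  filter_upwards [ae_eventually_notMem key2] with x hx
  filter_upwards [hx] with n hn
  simp only [mem_preimage, mem_ofPred_eq, mem_Ioi, not_lt, hZ] at hn
  rw [div_le_iff₀ hc] at hn
  linarith [le_max_left (Y (T^[n] x)) 0]

end ErgodicPart

section ChainPart

/-- cylinder sets -/
def cyl (n : ℕ) (p : ℕ → ℤ) : Set (ℕ → ℤ) := {f | ∀ k ≤ n, f k = p k}

lemma mem_cyl {n : ℕ} {p f : ℕ → ℤ} : f ∈ cyl n p ↔ ∀ k ≤ n, f k = p k := Iff.rfl

lemma cyl_measurable (n : ℕ) (p : ℕ → ℤ) : MeasurableSet (cyl n p) := by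
  have : cyl n p = ⋂ k, ⋂ (_ : k ≤ n), (fun f : ℕ → ℤ => f k) ⁻¹' {p k} := by
    ext f; simp [mem_cyl]
  rw [this]
  exact MeasurableSet.iInter fun k => MeasurableSet.iInter fun _ =>
    measurable_pi_apply k (measurableSet_singleton _)

/-- extension of a finite path by zero -/
def pext (n : ℕ) (b : Fin (n + 1) → ℤ) (k : ℕ) : ℤ := if h : k < n + 1 then b ⟨k, h⟩ else 0

/-- restriction of a path -/
def prest (n : ℕ) (f : ℕ → ℤ) : Fin (n + 1) → ℤ := fun i => f i

lemma mem_cyl_pext {n : ℕ} {f : ℕ → ℤ} {b : Fin (n + 1) → ℤ} :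
    f ∈ cyl n (pext n b) ↔ prest n f = b := by
  rw [mem_cyl, funext_iff]
  constructor
  · intro h i
    have := h i (by omega)
    simp only [pext, dif_pos i.2] at this
    exact this
  · intro h k hk
    have hk' : k < n + 1 := by omega
    have := h ⟨k, hk'⟩
    simpa [pext, prest, hk'] using this

lemma cyl_congr {n : ℕ} {p q : ℕ → ℤ} (h : ∀ k ≤ n, p k = q k) : cyl n p = cyl n q := by
  ext f; rw [mem_cyl, mem_cyl]
  exact forall₂_congr fun k hk => by rw [h k hk]

variable {env : ℤ → ℝ} {μ : Measure (ℕ → ℤ)}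

lemma ae_start (hμ : IsQuenchedRW env 0 μ) : ∀ᵐ f ∂μ, f 0 = 0 := by
  have := hμ.1
  have h := hμ.2 0 (fun _ => 0) rfl
  simp only [Finset.range_zero, Finset.prod_empty, ENNReal.ofReal_one] at h
  have h2 : μ {f : ℕ → ℤ | f 0 = 0} = 1 := by
    rw [← h]; congr 1; ext f; simp
  exact (prob_compl_eq_zero_iff (by
    exact measurable_pi_apply 0 (measurableSet_singleton _))).2 h2

lemma ae_step (hμ : IsQuenchedRW env 0 μ) :
    ∀ᵐ f ∂μ, ∀ n, f (n + 1) = f n + 1 ∨ f (n + 1) = f n - 1 := by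
  rw [ae_all_iff]
  intro n
  have key : ∀ b : Fin (n + 1 + 1) → ℤ, ∀ᵐ f ∂μ, f 0 = 0 → prest (n + 1) f = b →
      f (n + 1) = f n + 1 ∨ f (n + 1) = f n - 1 := by
    intro b
    set p := pext (n + 1) b with hp
    by_cases hb0 : p 0 = 0
    · by_cases hb : p (n + 1) = p n + 1 ∨ p (n + 1) = p n - 1
      · refine Eventually.of_forall fun f _ hf => ?_
        have hf' := mem_cyl_pext.2 hf
        rw [hf' (n + 1) le_rfl, hf' n (by omega)]
        exact hb
      · have h0 : μ (cyl (n + 1) p) = 0 := by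
          refine (hμ.2 (n + 1) p hb0).trans ?_
          rw [Finset.prod_range_succ]
          have : stepProb env (p n) (p (n + 1)) = 0 := by
            push Not at hb
            simp [stepProb, hb.1, hb.2]
          rw [this]; simp
        have : ∀ᵐ f ∂μ, f ∉ cyl (n + 1) p := measure_eq_zero_iff_ae_notMem.1 h0
        filter_upwards [this] with f hf _ hf'
        exact absurd (mem_cyl_pext.2 hf') hf
    · refine Eventually.of_forall fun f hf0 hf => ?_
      have hf' := mem_cyl_pext.2 hf
      exact absurd ((hf' 0 (by omega)).symm.trans hf0) hb0
  filter_upwards [ae_all_iff.2 key, ae_start hμ] with f h1 h2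
  exact h1 _ h2 rfl

lemma abs_le_of_steps {f : ℕ → ℤ} (h0 : f 0 = 0)
    (hs : ∀ n, f (n + 1) = f n + 1 ∨ f (n + 1) = f n - 1) (n : ℕ) : |f n| ≤ n := by
  induction n with
  | zero => simp [h0]
  | succ n ih =>
    rw [abs_le] at ih ⊢
    push_cast
    rcases hs n with h | h <;> omega

lemma meas_comp (h : ℤ → ℝ) (n : ℕ) : Measurable (fun f : ℕ → ℤ => h (f n)) :=
  (Measurable.of_discrete (f := h)).comp (measurable_pi_apply n)

lemma integrable_h (hμ : IsQuenchedRW env 0 μ) (h : ℤ → ℝ) (n : ℕ) :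
    Integrable (fun f : ℕ → ℤ => h (f n)) μ := by
  have := hμ.1
  obtain ⟨C, hC⟩ := ((Set.finite_Icc (-(n : ℤ)) n).image (fun x => ‖h x‖)).bddAbove
  refine Integrable.of_bound (meas_comp h n).aestronglyMeasurable C ?_
  filter_upwards [ae_start hμ, ae_step hμ] with f h0 hs
  exact hC ⟨f n, abs_le.1 (abs_le_of_steps h0 hs n), rfl⟩

lemma setIntegral_cyl_const (h : ℤ → ℝ) {n k : ℕ} (hk : k ≤ n)
    (p : ℕ → ℤ) : ∫ f in cyl n p, h (f k) ∂μ = μ.real (cyl n p) * h (p k) := by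
  rw [setIntegral_congr_fun (g := fun _ => h (p k)) (cyl_measurable n p)
    (fun f hf => by simp only [hf k hk])]
  simp

lemma integral_step (h01 : ∀ x, env x ∈ Ioo (0 : ℝ) 1) (hμ : IsQuenchedRW env 0 μ) (h : ℤ → ℝ)
    (harm : ∀ x, h x = env x * h (x + 1) + (1 - env x) * h (x - 1)) (n : ℕ) (p : ℕ → ℤ) :
    ∫ f in cyl n p, h (f n) ∂μ = ∫ f in cyl n p, h (f (n + 1)) ∂μ := by
  have := hμ.1
  by_cases hp0 : p 0 = 0
  swap
  · have h0 : μ (cyl n p) = 0 := by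
      rw [measure_eq_zero_iff_ae_notMem]
      filter_upwards [ae_start hμ] with f hf hf'
      exact hp0 ((hf' 0 (by omega)).symm.trans hf)
    rw [setIntegral_measure_zero _ h0, setIntegral_measure_zero _ h0]
  set pu : ℕ → ℤ := Function.update p (n + 1) (p n + 1) with hpu
  set pd : ℕ → ℤ := Function.update p (n + 1) (p n - 1) with hpd
  have eu : ∀ k ≤ n, pu k = p k := fun k hk => by
    rw [hpu, Function.update_of_ne (by omega)]
  have ed : ∀ k ≤ n, pd k = p k := fun k hk => by
    rw [hpd, Function.update_of_ne (by omega)]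
  have eu' : pu (n + 1) = p n + 1 := by simp [hpu]
  have ed' : pd (n + 1) = p n - 1 := by simp [hpd]
  have hsplit : (cyl n p : Set (ℕ → ℤ)) =ᵐ[μ] (cyl (n + 1) pu ∪ cyl (n + 1) pd : Set _) := by
    rw [eventuallyEq_set]
    filter_upwards [ae_step hμ] with f hf
    rw [mem_union, mem_cyl, mem_cyl, mem_cyl]
    constructor
    · intro hf'
      rcases hf n with h1 | h1
      · left
        intro k hk
        rcases Nat.le_succ_iff.1 hk with hk | rfl
        · rw [eu k hk, hf' k hk]
        · rw [eu', h1, hf' n le_rfl]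
      · right
        intro k hk
        rcases Nat.le_succ_iff.1 hk with hk | rfl
        · rw [ed k hk, hf' k hk]
        · rw [ed', h1, hf' n le_rfl]
    · rintro (h1 | h1) k hk
      · rw [h1 k (by omega), eu k hk]
      · rw [h1 k (by omega), ed k hk]
  have hdisj : Disjoint (cyl (n + 1) pu) (cyl (n + 1) pd) := by
    rw [Set.disjoint_left]
    intro f h1 h2
    have a1 := h1 (n + 1) le_rfl
    have a2 := h2 (n + 1) le_rfl
    rw [eu'] at a1; rw [ed'] at a2
    omega
  have hnn : ∀ (m : ℕ) (q : ℕ → ℤ), 0 ≤ ∏ k ∈ Finset.range m, stepProb env (q k) (q (k + 1)) := by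
    intro m q
    refine Finset.prod_nonneg fun k _ => ?_
    have := h01 (q k)
    unfold stepProb
    split_ifs
    · exact this.1.le
    · linarith [this.2]
    · exact le_rfl
  have hreal : ∀ (m : ℕ) (q : ℕ → ℤ), q 0 = 0 →
      μ.real (cyl m q) = ∏ k ∈ Finset.range m, stepProb env (q k) (q (k + 1)) := by
    intro m q hq
    have := hμ.2 m q hq
    rw [Measure.real, show cyl m q = {f | ∀ k ≤ m, f k = q k} from rfl, this,
      ENNReal.toReal_ofReal (hnn m q)]
  have hru : μ.real (cyl (n + 1) pu) = μ.real (cyl n p) * env (p n) := by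
    rw [hreal _ _ ((eu 0 (by omega)).trans hp0), hreal _ _ hp0, Finset.prod_range_succ]
    congr 1
    · refine Finset.prod_congr rfl fun k hk => ?_
      rw [Finset.mem_range] at hk
      rw [eu k (by omega), eu (k + 1) (by omega)]
    · rw [eu', eu n le_rfl]; simp [stepProb]
  have hrd : μ.real (cyl (n + 1) pd) = μ.real (cyl n p) * (1 - env (p n)) := by
    rw [hreal _ _ ((ed 0 (by omega)).trans hp0), hreal _ _ hp0, Finset.prod_range_succ]
    congr 1
    · refine Finset.prod_congr rfl fun k hk => ?_
      rw [Finset.mem_range] at hk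
      rw [ed k (by omega), ed (k + 1) (by omega)]
    · rw [ed', ed n le_rfl]
      have : p n - 1 ≠ p n + 1 := by omega
      simp [stepProb, this]
  rw [setIntegral_cyl_const h le_rfl, setIntegral_congr_set hsplit,
    setIntegral_union hdisj (cyl_measurable _ _) (integrable_h hμ h _).integrableOn
      (integrable_h hμ h _).integrableOn,
    setIntegral_cyl_const h le_rfl, setIntegral_cyl_const h le_rfl, hru, hrd, eu', ed']
  conv_lhs => rw [harm (p n)]
  ring

lemma meas_piLE {j k : ℕ} (hjk : j ≤ k) :
    Measurable[Filtration.piLE (X := fun _ : ℕ => ℤ) k] (fun f : ℕ → ℤ => f j) := by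
  have h1 : Measurable (fun g : Set.Iic k → ℤ => g ⟨j, hjk⟩) := measurable_pi_apply _
  exact h1.comp (comap_measurable _)

lemma submart (h01 : ∀ x, env x ∈ Ioo (0 : ℝ) 1) (hμ : IsQuenchedRW env 0 μ) (h : ℤ → ℝ)
    (harm : ∀ x, h x = env x * h (x + 1) + (1 - env x) * h (x - 1)) :
    Submartingale (fun n (f : ℕ → ℤ) => h (f n)) (Filtration.piLE (X := fun _ : ℕ => ℤ)) μ := by
  have := hμ.1
  refine submartingale_of_setIntegral_le_succ ?_ (fun n => integrable_h hμ h n) ?_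
  · intro n
    exact ((Measurable.of_discrete (f := h)).comp (meas_piLE le_rfl)).stronglyMeasurable
  · intro n s hs
    have hsm : MeasurableSet s := (Filtration.piLE (X := fun _ : ℕ => ℤ)).le n s hs
    obtain ⟨B, -, rfl⟩ := hs
    set s : Set (ℕ → ℤ) := (Preorder.restrictLe n) ⁻¹' B with hsdef
    have hdep : ∀ f g : ℕ → ℤ, (∀ k ≤ n, f k = g k) → f ∈ s → g ∈ s := by
      intro f g hfg hf
      have : Preorder.restrictLe (π := fun _ : ℕ => ℤ) n f = Preorder.restrictLe n g := by
        ext ⟨k, hk⟩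
        exact hfg k hk
      rw [hsdef, mem_preimage, ← this]
      exact hf
    have hU : s = ⋃ b : Fin (n + 1) → ℤ, s ∩ cyl n (pext n b) := by
      ext f
      simp only [mem_iUnion, mem_inter_iff, mem_cyl_pext]
      constructor
      · intro hf; exact ⟨_, hf, rfl⟩
      · rintro ⟨_, hf, _⟩; exact hf
    have hm : ∀ b : Fin (n + 1) → ℤ, MeasurableSet (s ∩ cyl n (pext n b)) := fun b =>
      hsm.inter (cyl_measurable _ _)
    have hd : Pairwise (Function.onFun Disjoint fun b : Fin (n + 1) → ℤ => s ∩ cyl n (pext n b)) := by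
      intro b c hbc
      rw [Function.onFun, Set.disjoint_left]
      rintro f ⟨_, h1⟩ ⟨_, h2⟩
      exact hbc ((mem_cyl_pext.1 h1).symm.trans (mem_cyl_pext.1 h2))
    apply le_of_eq
    rw [hU, integral_iUnion hm hd (integrable_h hμ h _).integrableOn,
      integral_iUnion hm hd (integrable_h hμ h _).integrableOn]
    congr 1
    ext b
    by_cases hb : pext n b ∈ s
    · have : s ∩ cyl n (pext n b) = cyl n (pext n b) := by
        apply inter_eq_right.2
        intro f hf
        exact hdep _ _ (fun k hk => (hf k hk).symm) hb
      rw [this]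
      exact integral_step h01 hμ h harm n _
    · have : s ∩ cyl n (pext n b) = ∅ := by
        ext f
        simp only [mem_inter_iff, mem_empty_iff_false, iff_false, not_and]
        intro hf hf'
        exact hb (hdep _ _ hf' hf)
      simp [this]

lemma submart_tendsto {Ω : Type*} {m0 : MeasurableSpace Ω} {ν : Measure Ω} [IsProbabilityMeasure ν]
    {G : Filtration ℕ m0} {F : ℕ → Ω → ℝ} (hF : Submartingale F G ν) (C : ℝ)
    (hC : ∀ n, ∀ᵐ x ∂ν, F n x ≤ C) :
    ∀ᵐ x ∂ν, ∃ c, Tendsto (fun n => F n x) atTop (𝓝 c) := by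
  refine hF.exists_ae_tendsto_of_bdd (R := Real.toNNReal (2 * |C| - ∫ x, F 0 x ∂ν)) fun n => ?_
  rw [eLpNorm_one_eq_lintegral_enorm, ← ofReal_integral_norm_eq_lintegral_enorm (hF.integrable n)]
  apply ENNReal.ofReal_le_ofReal
  have h1 : ∫ x, ‖F n x‖ ∂ν ≤ ∫ x, (2 * |C| - F n x) ∂ν := by
    refine integral_mono_ae (hF.integrable n).norm ((integrable_const _).sub (hF.integrable n)) ?_
    filter_upwards [hC n] with x hx
    rw [Real.norm_eq_abs]
    have := le_abs_self C
    have := abs_nonneg C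
    rcases abs_cases (F n x) with ⟨h, _⟩ | ⟨h, _⟩ <;> rw [h] <;> linarith
  have h2 : ∫ x, F 0 x ∂ν ≤ ∫ x, F n x ∂ν := by
    have := hF.setIntegral_le (Nat.zero_le n) (s := Set.univ) MeasurableSet.univ
    simpa using this
  rw [integral_sub (integrable_const _) (hF.integrable n)] at h1
  simp only [integral_const, probReal_univ, one_smul] at h1
  linarith

lemma tendsto_of_h {h : ℤ → ℝ} (hmono : StrictMono h) (hbot : Tendsto h atBot atBot)
    {X : ℕ → ℤ} (hs : ∀ n, X (n + 1) = X n + 1 ∨ X (n + 1) = X n - 1) {l : ℝ}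
    (hl : Tendsto (fun n => h (X n)) atTop (𝓝 l)) : Tendsto X atTop atTop := by
  rw [tendsto_atTop]
  intro K
  by_contra hK
  have hfr : ∃ᶠ n in atTop, X n < K := by
    rw [Filter.not_eventually] at hK
    exact hK.mono fun n hn => not_le.1 hn
  have hlK : l ≤ h K := by
    by_contra hlt
    push Not at hlt
    have := hl.eventually_const_lt hlt
    obtain ⟨n, h1, h2⟩ := (hfr.and_eventually this).exists
    exact absurd (hmono.lt_iff_lt.1 h2) (by omega)
  have hev1 : ∀ᶠ n in atTop, X n < K + 1 := by
    have : l < h (K + 1) := hlK.trans_lt (hmono (by omega))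
    filter_upwards [hl.eventually_lt_const this] with n hn
    exact hmono.lt_iff_lt.1 hn
  obtain ⟨L, hL⟩ := (hbot.eventually_lt_atBot (l - 1)).exists
  have hev2 : ∀ᶠ n in atTop, L < X n := by
    have : h L < l := by linarith
    filter_upwards [hl.eventually_const_lt this] with n hn
    exact hmono.lt_iff_lt.1 hn
  -- the gap
  obtain ⟨δ, hδ, hgap⟩ : ∃ δ > 0, ∀ i ∈ Finset.Icc (L - 1) (K + 1), δ ≤ h (i + 1) - h i := by
    have hne : (Finset.Icc (L - 1) (K + 1)).Nonempty := by
      obtain ⟨n, h1, h2⟩ := (hev1.and hev2).exists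
      exact ⟨X n, by rw [Finset.mem_Icc]; omega⟩
    obtain ⟨i, hi, hmin⟩ := Finset.exists_min_image _ (fun i => h (i + 1) - h i) hne
    exact ⟨h (i + 1) - h i, sub_pos.2 (hmono (by omega)), hmin⟩
  have hdiff : Tendsto (fun n => h (X (n + 1)) - h (X n)) atTop (𝓝 0) := by
    have := ((tendsto_add_atTop_iff_nat 1).2 hl).sub hl
    simpa using this
  have hab := hdiff.abs
  rw [abs_zero] at hab
  obtain ⟨n, ⟨h1, h2⟩, h3⟩ := ((hev1.and hev2).and (hab.eventually_lt_const hδ)).exists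
  rcases hs n with h4 | h4 <;> rw [h4] at h3
  · have := hgap (X n) (by rw [Finset.mem_Icc]; omega)
    linarith [le_abs_self (h (X n + 1) - h (X n))]
  · have := hgap (X n - 1) (by rw [Finset.mem_Icc]; omega)
    rw [sub_add_cancel] at this
    linarith [neg_abs_le (h (X n - 1) - h (X n))]

/-- transience to the right -/
lemma chain_right (h01 : ∀ x, env x ∈ Ioo (0 : ℝ) 1) (hμ : IsQuenchedRW env 0 μ) (h : ℤ → ℝ)
    (harm : ∀ x, h x = env x * h (x + 1) + (1 - env x) * h (x - 1))
    (hmono : StrictMono h) (hbot : Tendsto h atBot atBot) (hbdd : BddAbove (range h)) :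
    ∀ᵐ f ∂μ, Tendsto (fun n => f n) atTop atTop := by
  have := hμ.1
  obtain ⟨C, hC⟩ := hbdd
  filter_upwards [ae_step hμ, submart_tendsto (submart h01 hμ h harm) C
    (fun n => Eventually.of_forall fun f => hC ⟨f n, rfl⟩)] with f hs ⟨l, hl⟩
  exact tendsto_of_h hmono hbot hs hl

/-- reaching arbitrarily far to the right -/
lemma chain_sup (h01 : ∀ x, env x ∈ Ioo (0 : ℝ) 1) (hμ : IsQuenchedRW env 0 μ) (h : ℤ → ℝ)
    (harm : ∀ x, h x = env x * h (x + 1) + (1 - env x) * h (x - 1))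
    (hmono : StrictMono h) (hbot : Tendsto h atBot atBot) :
    ∀ᵐ f ∂μ, ∀ m : ℕ, ∃ n, (m : ℤ) ≤ f n := by
  classical
  have := hμ.1
  rw [ae_all_iff]
  intro m
  rcases Nat.eq_zero_or_pos m with rfl | hm
  · filter_upwards [ae_start hμ] with f hf
    exact ⟨0, by rw [hf]; simp⟩
  set A : ℕ → (ℕ → ℤ) → ℝ := fun k f => if ∀ j ≤ k, f j < m then 1 else 0 with hA
  have hAad : StronglyAdapted (Filtration.piLE (X := fun _ : ℕ => ℤ)) A := by
    intro k
    refine Measurable.stronglyMeasurable ?_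
    refine Measurable.ite ?_ measurable_const measurable_const
    have : {f : ℕ → ℤ | ∀ j ≤ k, f j < m} =
        ⋂ j, ⋂ (_ : j ≤ k), (fun f : ℕ → ℤ => f j) ⁻¹' (Set.Iio (m : ℤ)) := by
      ext f; simp
    rw [this]
    exact MeasurableSet.iInter fun j => MeasurableSet.iInter fun hj =>
      meas_piLE hj measurableSet_Iio
  have hsub := (submart h01 hμ h harm).sum_mul_sub hAad (R := 1)
    (fun n f => by simp only [hA]; split_ifs <;> norm_num)
    (fun n f => by simp only [hA]; split_ifs <;> norm_num)
  set F : ℕ → (ℕ → ℤ) → ℝ := fun n => ∑ k ∈ Finset.range n, A k *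
    ((fun f : ℕ → ℤ => h (f (k + 1))) - (fun f : ℕ → ℤ => h (f k))) with hF
  have hFs : ∀ n f, F (n + 1) f = F n f + A n f * (h (f (n + 1)) - h (f n)) := by
    intro n f
    simp only [hF, Finset.sum_range_succ, Pi.add_apply, Pi.mul_apply, Pi.sub_apply]
  have hF0 : ∀ f, F 0 f = 0 := fun f => by simp [hF]
  have hFeq : ∀ f : ℕ → ℤ, f 0 = 0 → ∀ n, (∀ j ≤ n, f j < m) → F n f = h (f n) - h 0 := by
    intro f hf0 n
    induction n with
    | zero => intro _; rw [hF0, hf0]; ring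
    | succ n ih =>
      intro hj
      have hj' : ∀ j ≤ n, f j < m := fun j hjn => hj j (by omega)
      rw [hFs, ih hj']
      simp only [hA, if_pos hj']
      ring
  have hFle : ∀ f : ℕ → ℤ, f 0 = 0 → (∀ n, f (n + 1) = f n + 1 ∨ f (n + 1) = f n - 1) →
      ∀ n, F n f ≤ h m - h 0 := by
    intro f hf0 hs n
    induction n with
    | zero =>
      rw [hF0]
      have := hmono.monotone (show (0 : ℤ) ≤ m by omega)
      linarith
    | succ n ih =>
      rw [hFs]
      by_cases hj : ∀ j ≤ n, f j < m
      · rw [hFeq f hf0 n hj]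
        simp only [hA, if_pos hj]
        have h1 : f (n + 1) ≤ m := by
          have := hj n le_rfl
          rcases hs n with h | h <;> omega
        have := hmono.monotone h1
        linarith
      · simp only [hA, if_neg hj]
        linarith
  filter_upwards [ae_start hμ, ae_step hμ, submart_tendsto hsub (h m - h 0) (fun n => by
    filter_upwards [ae_start hμ, ae_step hμ] with f h0 hs using hFle f h0 hs n)]
    with f h0 hs ⟨l, hl⟩
  by_contra hcon
  push Not at hcon
  have hl' : Tendsto (fun n => h (f n)) atTop (𝓝 (l + h 0)) := by
    refine (hl.add_const (h 0)).congr fun n => ?_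
    have := hFeq f h0 n (fun j _ => hcon j)
    change F n f + h 0 = _
    linarith
  have htop := tendsto_of_h hmono hbot hs hl'
  obtain ⟨n, hn⟩ := (htop.eventually_ge_atTop (m : ℤ)).exists
  exact absurd (hcon n) (not_lt.2 hn)

lemma reflect_rw (hμ : IsQuenchedRW env 0 μ) :
    IsQuenchedRW (fun x => 1 - env (-x)) 0 (μ.map (fun f n => - f n)) := by
  have hm : Measurable (fun (f : ℕ → ℤ) (n : ℕ) => - f n) :=
    measurable_pi_lambda _ fun n => (measurable_pi_apply n).neg
  have := hμ.1
  refine ⟨Measure.isProbabilityMeasure_map hm.aemeasurable, fun n p hp => ?_⟩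
  have e := Measure.map_apply (μ := μ) hm (cyl_measurable n p)
  refine e.trans ?_
  have h2 := hμ.2 n (fun k => - p k) (by simp [hp])
  have h3 : (fun (f : ℕ → ℤ) (n : ℕ) => - f n) ⁻¹' (cyl n p) = {f | ∀ k ≤ n, f k = - p k} := by
    ext f
    simp only [mem_preimage, mem_cyl]
    exact forall₂_congr fun k _ => neg_eq_iff_eq_neg
  rw [h3, h2]
  congr 1
  refine Finset.prod_congr rfl fun k _ => ?_
  unfold stepProb
  by_cases h1 : p (k + 1) = p k + 1
  · have a1 : - p (k + 1) ≠ - p k + 1 := by omega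
    have a2 : - p (k + 1) = - p k - 1 := by omega
    rw [if_neg a1, if_pos a2, if_pos h1]
  · by_cases h2 : p (k + 1) = p k - 1
    · have a2 : - p (k + 1) = - p k + 1 := by omega
      rw [if_pos a2, if_neg h1, if_pos h2]; ring
    · have a1 : ¬ - p (k + 1) = - p k + 1 := by omega
      have a2 : ¬ - p (k + 1) = - p k - 1 := by omega
      rw [if_neg a1, if_neg a2, if_neg h1, if_neg h2]

lemma reflect_harm {h : ℤ → ℝ} (harm : ∀ x, h x = env x * h (x + 1) + (1 - env x) * h (x - 1)) :
    ∀ x, (fun x => - h (-x)) x = (fun x => 1 - env (-x)) x * (fun x => - h (-x)) (x + 1)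
      + (1 - (fun x => 1 - env (-x)) x) * (fun x => - h (-x)) (x - 1) := by
  intro x
  simp only
  rw [harm (-x), show -(x + 1) = -x - 1 by ring, show -(x - 1) = -x + 1 by ring]
  ring

lemma reflect_mono {h : ℤ → ℝ} (hmono : StrictMono h) : StrictMono (fun x => - h (-x)) := by
  intro x y hxy
  exact neg_lt_neg (hmono (neg_lt_neg hxy))

lemma reflect_bot {h : ℤ → ℝ} (htop : Tendsto h atTop atTop) :
    Tendsto (fun x => - h (-x)) atBot atBot :=
  tendsto_neg_atTop_atBot.comp (htop.comp tendsto_neg_atBot_atTop)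

lemma chain_left (h01 : ∀ x, env x ∈ Ioo (0 : ℝ) 1) (hμ : IsQuenchedRW env 0 μ) (h : ℤ → ℝ)
    (harm : ∀ x, h x = env x * h (x + 1) + (1 - env x) * h (x - 1))
    (hmono : StrictMono h) (htop : Tendsto h atTop atTop) (hbdd : BddBelow (range h)) :
    ∀ᵐ f ∂μ, Tendsto (fun n => f n) atTop atBot := by
  have hm : Measurable (fun (f : ℕ → ℤ) (n : ℕ) => - f n) :=
    measurable_pi_lambda _ fun n => (measurable_pi_apply n).neg
  have key := chain_right (env := fun x => 1 - env (-x))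
    (fun x => ⟨by linarith [(h01 (-x)).2], by linarith [(h01 (-x)).1]⟩)
    (reflect_rw hμ) (fun x => - h (-x)) (reflect_harm harm) (reflect_mono hmono)
    (reflect_bot htop) (by
      obtain ⟨C, hC⟩ := hbdd
      refine ⟨-C, ?_⟩
      rintro _ ⟨x, rfl⟩
      exact neg_le_neg (hC ⟨-x, rfl⟩))
  have := ae_of_ae_map hm.aemeasurable key
  filter_upwards [this] with f hf
  have := tendsto_neg_atTop_atBot.comp hf
  refine this.congr fun n => ?_
  simp

lemma chain_inf (h01 : ∀ x, env x ∈ Ioo (0 : ℝ) 1) (hμ : IsQuenchedRW env 0 μ) (h : ℤ → ℝ)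
    (harm : ∀ x, h x = env x * h (x + 1) + (1 - env x) * h (x - 1))
    (hmono : StrictMono h) (htop : Tendsto h atTop atTop) :
    ∀ᵐ f ∂μ, ∀ m : ℕ, ∃ n, f n ≤ -(m : ℤ) := by
  have hm : Measurable (fun (f : ℕ → ℤ) (n : ℕ) => - f n) :=
    measurable_pi_lambda _ fun n => (measurable_pi_apply n).neg
  have key := chain_sup (env := fun x => 1 - env (-x))
    (fun x => ⟨by linarith [(h01 (-x)).2], by linarith [(h01 (-x)).1]⟩)
    (reflect_rw hμ) (fun x => - h (-x)) (reflect_harm harm) (reflect_mono hmono)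
    (reflect_bot htop)
  have := ae_of_ae_map hm.aemeasurable key
  filter_upwards [this] with f hf m
  obtain ⟨n, hn⟩ := hf m
  exact ⟨n, by omega⟩

lemma limsup_top {X : ℕ → ℤ} (hX : ∀ m : ℕ, ∃ n, (m : ℤ) ≤ X n) :
    atTop.limsup (fun n => ((X n : ℝ) : EReal)) = ⊤ := by
  rw [EReal.eq_top_iff_forall_lt]
  intro y
  obtain ⟨M, hM⟩ := exists_nat_gt y
  refine lt_of_lt_of_le (EReal.coe_lt_coe_iff.2 hM) ?_
  refine le_limsup_of_frequently_le' ?_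
  rw [frequently_atTop]
  intro N
  obtain ⟨C, hC⟩ := ((Set.finite_Iio N).image X).bddAbove
  obtain ⟨n, hn⟩ := hX (M + (C + 1).toNat)
  refine ⟨n, ?_, ?_⟩
  · by_contra hlt
    have := hC ⟨n, not_le.1 hlt, rfl⟩
    push_cast at hn
    omega
  · have : ((M : ℕ) : ℤ) ≤ X n := by push_cast at hn; omega
    exact EReal.coe_le_coe_iff.2 (by exact_mod_cast this)

lemma liminf_bot {X : ℕ → ℤ} (hX : ∀ m : ℕ, ∃ n, X n ≤ -(m : ℤ)) :
    atTop.liminf (fun n => ((X n : ℝ) : EReal)) = ⊥ := by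
  have h := limsup_top (X := fun n => - X n) (fun m => by
    obtain ⟨n, hn⟩ := hX m
    exact ⟨n, by omega⟩)
  have e : (fun n => (((- X n : ℤ) : ℝ) : EReal)) = - (fun n => ((X n : ℝ) : EReal)) := by
    ext n; simp
  rw [e, EReal.limsup_neg] at h
  exact EReal.neg_eq_top_iff.1 h

end ChainPart

section SparsePart

/-- discrete antiderivative -/
def adiff (u : ℤ → ℝ) (n : ℤ) : ℝ :=
  ∑ i ∈ Finset.range n.toNat, u (i + 1) - ∑ i ∈ Finset.range (-n).toNat, u (-i)

lemma adiff_zero (u : ℤ → ℝ) : adiff u 0 = 0 := by simp [adiff]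

lemma adiff_nat (u : ℤ → ℝ) (n : ℕ) : adiff u n = ∑ i ∈ Finset.range n, u (i + 1) := by
  simp [adiff]

lemma adiff_neg (u : ℤ → ℝ) (n : ℕ) : adiff u (-n) = - ∑ i ∈ Finset.range n, u (-i) := by
  simp [adiff]

lemma adiff_rec (u : ℤ → ℝ) (n : ℤ) : adiff u n - adiff u (n - 1) = u n := by
  unfold adiff
  rcases le_or_gt n 0 with h | h
  · have h1 : n.toNat = 0 := by omega
    have h2 : (n - 1).toNat = 0 := by omega
    have h3 : (-(n - 1)).toNat = (-n).toNat + 1 := by omega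
    have h4 : (((-n).toNat : ℕ) : ℤ) = -n := by omega
    rw [h1, h2, h3, Finset.sum_range_succ, h4]
    simp
  · have h1 : (-n).toNat = 0 := by omega
    have h2 : (-(n - 1)).toNat = 0 := by omega
    have h3 : n.toNat = (n - 1).toNat + 1 := by omega
    have h4 : (((n - 1).toNat : ℕ) : ℤ) = n - 1 := by omega
    rw [h1, h2, h3, Finset.sum_range_succ, h4]
    simp

lemma eq_of_rec {f g : ℤ → ℝ} (h0 : f 0 = g 0)
    (hr : ∀ k, f k - f (k - 1) = g k - g (k - 1)) (k : ℤ) : f k = g k := by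
  induction k using Int.induction_on with
  | zero => exact h0
  | succ i ih =>
    have := hr (i + 1)
    rw [add_sub_cancel_right] at this
    linarith
  | pred i ih =>
    have := hr (-i)
    linarith

variable {lam : ℤ → ℝ} {d : ℤ → ℕ} {a : ℤ → ℤ}

lemma a_strictMono (hd : ∀ k, 1 ≤ d k) (ha : ∀ k : ℤ, a k - a (k - 1) = d k) : StrictMono a := by
  refine strictMono_int_of_lt_succ fun k => ?_
  have h1 := ha (k + 1)
  have h2 := hd (k + 1)
  rw [add_sub_cancel_right] at h1
  omega

lemma sparse_at (hmono : StrictMono a) (k : ℤ) : sparseEnv lam a (a k) = lam k := by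
  have h : ∃ j, a j = a k := ⟨k, rfl⟩
  unfold sparseEnv
  rw [dif_pos h]
  rw [hmono.injective h.choose_spec]

lemma sparse_off {x : ℤ} (h : ¬ ∃ j, a j = x) : sparseEnv lam a x = 1 / 2 := by
  unfold sparseEnv
  rw [dif_neg h]

lemma sparse_mem (hlam : ∀ k, lam k ∈ Ioo (0 : ℝ) 1) (x : ℤ) :
    sparseEnv lam a x ∈ Ioo (0 : ℝ) 1 := by
  unfold sparseEnv
  split_ifs
  · exact hlam _
  · norm_num

lemma exists_scale (hlam : ∀ k, lam k ∈ Ioo (0 : ℝ) 1) (hd : ∀ k, 1 ≤ d k) (ha0 : a 0 = 0)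
    (ha : ∀ k : ℤ, a k - a (k - 1) = d k) :
    ∃ h : ℤ → ℝ, StrictMono h ∧
      (∀ x, h x = sparseEnv lam a x * h (x + 1) + (1 - sparseEnv lam a x) * h (x - 1)) ∧
      h 0 = 0 ∧ ∀ k, h (a k) - h (a (k - 1)) =
        d k * Real.exp (adiff (fun j => Real.log ((1 - lam j) / lam j)) (k - 1)) := by
  have hmono := a_strictMono hd ha
  set env := sparseEnv lam a with henv
  set V := adiff (fun x => Real.log ((1 - env x) / env x)) with hV
  have hVr : ∀ x, V x - V (x - 1) = Real.log ((1 - env x) / env x) := adiff_rec _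
  set h := adiff (fun x => Real.exp (V (x - 1))) with hh
  have hhr : ∀ x, h x - h (x - 1) = Real.exp (V (x - 1)) := adiff_rec _
  have hoff : ∀ k : ℤ, ∀ j : ℕ, 0 < j → j < d k → ¬ ∃ i, a i = a (k - 1) + j := by
    rintro k j hj0 hj ⟨i, hi⟩
    have h1 : a (k - 1) < a i := by omega
    have h2 : a i < a k := by have := ha k; omega
    have := hmono.lt_iff_lt.1 h1
    have := hmono.lt_iff_lt.1 h2
    omega
  have hVconst : ∀ k : ℤ, ∀ j : ℕ, j < d k → V (a (k - 1) + j) = V (a (k - 1)) := by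
    intro k j
    induction j with
    | zero => simp
    | succ j ih =>
      intro hj
      have h1 := hVr (a (k - 1) + (j + 1 : ℕ))
      have h2 : env (a (k - 1) + (j + 1 : ℕ)) = 1 / 2 := sparse_off (hoff k (j + 1) (by omega) hj)
      rw [h2, show a (k - 1) + ((j + 1 : ℕ) : ℤ) - 1 = a (k - 1) + j by push_cast; ring,
        ih (by omega)] at h1
      norm_num at h1
      push_cast
      linarith
  have hVS : ∀ k, V (a k) = adiff (fun j => Real.log ((1 - lam j) / lam j)) k := by
    refine eq_of_rec ?_ ?_
    · rw [ha0, adiff_zero, hV, adiff_zero]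
    · intro k
      rw [adiff_rec]
      have h1 := hVr (a k)
      rw [henv, sparse_at hmono k] at h1
      rw [← h1]
      have h2 := ha k
      have h3 := hd k
      have h4 := hVconst k (d k - 1) (by omega)
      have h5 : a (k - 1) + ((d k - 1 : ℕ) : ℤ) = a k - 1 := by omega
      rw [h5] at h4
      rw [h4]
  refine ⟨h, ?_, ?_, adiff_zero _, ?_⟩
  · refine strictMono_int_of_lt_succ fun k => ?_
    have := hhr (k + 1)
    rw [add_sub_cancel_right] at this
    have := Real.exp_pos (V k)
    linarith
  · intro x
    have h1 := hhr (x + 1)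
    rw [add_sub_cancel_right] at h1
    have h2 := hhr x
    have hm : env x ∈ Ioo (0 : ℝ) 1 := sparse_mem hlam x
    have h3 : V x = Real.log ((1 - env x) / env x) + V (x - 1) := by linarith [hVr x]
    rw [h3, Real.exp_add, Real.exp_log (div_pos (by linarith [hm.2]) hm.1), ← h2] at h1
    have hne : env x ≠ 0 := hm.1.ne'
    field_simp at h1
    linarith
  · intro k
    have key : ∀ j : ℕ, j ≤ d k →
        h (a (k - 1) + j) - h (a (k - 1)) = j * Real.exp (V (a (k - 1))) := by
      intro j
      induction j with
      | zero => simp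
      | succ j ih =>
        intro hj
        have h1 := hhr (a (k - 1) + (j + 1 : ℕ))
        rw [show a (k - 1) + ((j + 1 : ℕ) : ℤ) - 1 = a (k - 1) + j by push_cast; ring,
          hVconst k j (by omega)] at h1
        have h2 := ih (by omega)
        push_cast at h1 ⊢
        linarith
    have h1 := key (d k) le_rfl
    rw [show a (k - 1) + (d k : ℤ) = a k by have := ha k; omega] at h1
    rw [h1, hVS]

lemma a_nat_ge (ha0 : a 0 = 0) (hd : ∀ k, 1 ≤ d k) (ha : ∀ k : ℤ, a k - a (k - 1) = d k) (n : ℕ) :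
    (n : ℤ) ≤ a n ∧ a (-n) ≤ -n := by
  induction n with
  | zero => simp [ha0]
  | succ n ih =>
    have h1 := ha (n + 1)
    have h2 := hd (n + 1)
    have h3 := ha (-n)
    have h4 := hd (-n)
    rw [add_sub_cancel_right] at h1
    push_cast
    rw [show (-((n : ℤ) + 1)) = -n - 1 by ring]
    omega

variable {h S : ℤ → ℝ}

lemma H_nat (h0 : h 0 = 0) (ha0 : a 0 = 0)
    (hH : ∀ k, h (a k) - h (a (k - 1)) = d k * Real.exp (S (k - 1))) (n : ℕ) :
    h (a n) = ∑ i ∈ Finset.range n, (d (i + 1) : ℝ) * Real.exp (S i) := by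
  induction n with
  | zero => simp [ha0, h0]
  | succ n ih =>
    have := hH (n + 1)
    rw [add_sub_cancel_right] at this
    rw [Finset.sum_range_succ, ← ih]
    push_cast
    linarith

lemma H_neg (h0 : h 0 = 0) (ha0 : a 0 = 0)
    (hH : ∀ k, h (a k) - h (a (k - 1)) = d k * Real.exp (S (k - 1))) (n : ℕ) :
    h (a (-n)) = - ∑ i ∈ Finset.range n, (d (-i) : ℝ) * Real.exp (S (-i - 1)) := by
  induction n with
  | zero => simp [ha0, h0]
  | succ n ih =>
    have := hH (-n)
    rw [Finset.sum_range_succ]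
    push_cast
    rw [show (-((n : ℤ) + 1)) = -n - 1 by ring]
    linarith

lemma right_bdd (hm : StrictMono h) (h0 : h 0 = 0) (ha0 : a 0 = 0) (hd : ∀ k, 1 ≤ d k)
    (ha : ∀ k : ℤ, a k - a (k - 1) = d k)
    (hH : ∀ k, h (a k) - h (a (k - 1)) = d k * Real.exp (S (k - 1)))
    (hs : Summable fun n : ℕ => (d (n + 1) : ℝ) * Real.exp (S n)) : BddAbove (range h) := by
  refine ⟨∑' n : ℕ, (d (n + 1) : ℝ) * Real.exp (S n), ?_⟩
  rintro _ ⟨x, rfl⟩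
  have h1 : x ≤ a x.toNat := by
    have := (a_nat_ge ha0 hd ha x.toNat).1
    omega
  refine (hm.monotone h1).trans ?_
  rw [H_nat h0 ha0 hH]
  exact hs.sum_le_tsum _ fun i _ => by positivity

lemma right_top (hm : StrictMono h) (h0 : h 0 = 0) (ha0 : a 0 = 0)
    (hH : ∀ k, h (a k) - h (a (k - 1)) = d k * Real.exp (S (k - 1)))
    (hs : ¬ Summable fun n : ℕ => (d (n + 1) : ℝ) * Real.exp (S n)) : Tendsto h atTop atTop := by
  have ht := (not_summable_iff_tendsto_nat_atTop_of_nonneg (fun n => by positivity)).1 hs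
  refine tendsto_atTop_atTop_of_monotone hm.monotone fun b => ?_
  obtain ⟨n, hn⟩ := (ht.eventually_ge_atTop b).exists
  exact ⟨a n, by rw [H_nat h0 ha0 hH]; exact hn⟩

lemma left_bdd (hm : StrictMono h) (h0 : h 0 = 0) (ha0 : a 0 = 0) (hd : ∀ k, 1 ≤ d k)
    (ha : ∀ k : ℤ, a k - a (k - 1) = d k)
    (hH : ∀ k, h (a k) - h (a (k - 1)) = d k * Real.exp (S (k - 1)))
    (hs : Summable fun n : ℕ => (d (-n) : ℝ) * Real.exp (S (-n - 1))) : BddBelow (range h) := by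
  refine ⟨-∑' n : ℕ, (d (-n) : ℝ) * Real.exp (S (-n - 1)), ?_⟩
  rintro _ ⟨x, rfl⟩
  have h1 : a (-((-x).toNat : ℕ)) ≤ x := by
    have := (a_nat_ge ha0 hd ha (-x).toNat).2
    omega
  refine le_trans ?_ (hm.monotone h1)
  rw [H_neg h0 ha0 hH]
  exact neg_le_neg (hs.sum_le_tsum _ fun i _ => by positivity)

lemma left_bot (hm : StrictMono h) (h0 : h 0 = 0) (ha0 : a 0 = 0)
    (hH : ∀ k, h (a k) - h (a (k - 1)) = d k * Real.exp (S (k - 1)))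
    (hs : ¬ Summable fun n : ℕ => (d (-n) : ℝ) * Real.exp (S (-n - 1))) : Tendsto h atBot atBot := by
  have ht := (not_summable_iff_tendsto_nat_atTop_of_nonneg (fun n => by positivity)).1 hs
  refine tendsto_atBot_atBot_of_monotone hm.monotone fun b => ?_
  obtain ⟨n, hn⟩ := (ht.eventually_ge_atTop (-b)).exists
  exact ⟨a (-n), by rw [H_neg h0 ha0 hH]; linarith⟩

lemma summable_of_decay {t : ℕ → ℝ} {e : ℕ → ℕ} {M c : ℝ} (hc : 0 < c)
    (ht : ∀ n : ℕ, t n ≤ M - c * n) (he1 : ∀ n, 1 ≤ e n)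
    (he : ∀ᶠ n : ℕ in atTop, Real.log (e n) ≤ c / 2 * n) :
    Summable fun n => (e n : ℝ) * Real.exp (t n) := by
  have hgeo : Summable fun n : ℕ => Real.exp M * (Real.exp (-(c / 2))) ^ n := by
    refine (summable_geometric_of_lt_one (Real.exp_pos _).le ?_).mul_left _
    rw [Real.exp_lt_one_iff]; linarith
  refine Summable.of_norm_bounded_eventually_nat hgeo ?_
  filter_upwards [he] with n hn
  have hpos : (0 : ℝ) < e n := by exact_mod_cast he1 n
  rw [Real.norm_of_nonneg (by positivity), ← Real.exp_nat_mul, ← Real.exp_add]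
  conv_lhs => rw [← Real.exp_log hpos]
  rw [← Real.exp_add]
  apply Real.exp_le_exp.2
  have := ht n
  linarith

lemma not_summable_of {t : ℕ → ℝ} {e : ℕ → ℕ} (he1 : ∀ n, 1 ≤ e n)
    (ht : ¬ Tendsto t atTop atBot) : ¬ Summable fun n => (e n : ℝ) * Real.exp (t n) := by
  intro hs
  apply ht
  have h1 := hs.tendsto_atTop_zero
  have h2 : Tendsto (fun n => Real.exp (t n)) atTop (𝓝 0) := by
    refine squeeze_zero (fun n => (Real.exp_pos _).le) (fun n => ?_) h1
    have : (1 : ℝ) ≤ e n := by exact_mod_cast he1 n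
    nlinarith [Real.exp_pos (t n)]
  exact Real.tendsto_exp_comp_nhds_zero.1 h2

end SparsePart

section FinalPart

/-- The forward shift. -/
def sT : (ℤ → ℝ × ℕ) → (ℤ → ℝ × ℕ) := fun f => fun n => f (n + 1)

/-- The backward shift. -/
def sT' : (ℤ → ℝ × ℕ) → (ℤ → ℝ × ℕ) := fun f => fun n => f (n - 1)

lemma sT_meas : Measurable sT := measurable_pi_lambda _ fun n => measurable_pi_apply (n + 1)

lemma sT'_meas : Measurable sT' := measurable_pi_lambda _ fun n => measurable_pi_apply (n - 1)

/-- The shift as a measurable equivalence. -/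
def sE : (ℤ → ℝ × ℕ) ≃ᵐ (ℤ → ℝ × ℕ) where
  toFun := sT
  invFun := sT'
  left_inv f := by funext n; simp [sT, sT']
  right_inv f := by funext n; simp [sT, sT']
  measurable_toFun := sT_meas
  measurable_invFun := sT'_meas

lemma sT_iter (k : ℕ) (f : ℤ → ℝ × ℕ) (n : ℤ) : sT^[k] f n = f (n + k) := by
  induction k generalizing f with
  | zero => simp
  | succ k ih =>
    rw [Function.iterate_succ_apply, ih]
    simp only [sT]; congr 1; push_cast; ring

lemma sT'_iter (k : ℕ) (f : ℤ → ℝ × ℕ) (n : ℤ) : sT'^[k] f n = f (n - k) := by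
  induction k generalizing f with
  | zero => simp
  | succ k ih =>
    rw [Function.iterate_succ_apply, ih]
    simp only [sT']; congr 1; push_cast; ring

/-- The logarithm of the ratio `ξ`. -/
def lg (p : ℝ × ℕ) : ℝ := Real.log ((1 - p.1) / p.1)

/-- The logarithm of `ξ₀` on sequence space. -/
def lF (f : ℤ → ℝ × ℕ) : ℝ := lg (f 0)

/-- The logarithm of `d₀` on sequence space. -/
def lD (f : ℤ → ℝ × ℕ) : ℝ := Real.log ((f 0).2 : ℝ)

lemma lF_meas : Measurable lF := by
  have h : Measurable fun f : ℤ → ℝ × ℕ => (f 0).1 := (measurable_pi_apply 0).fst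
  exact Real.measurable_log.comp ((measurable_const.sub h).div h)

lemma lD_meas : Measurable lD := by
  have h : Measurable fun f : ℤ → ℝ × ℕ => (f 0).2 := (measurable_pi_apply 0).snd
  exact Real.measurable_log.comp ((measurable_from_top (f := fun n : ℕ => (n : ℝ))).comp h)

/-- The potential. -/
def pot (f : ℤ → ℝ × ℕ) : ℤ → ℝ := adiff fun j => lg (f j)

lemma pot_nat (f : ℤ → ℝ × ℕ) (n : ℕ) : pot f n = birkhoffSum sT lF n (sT f) := by
  rw [pot, adiff_nat, birkhoffSum]
  refine Finset.sum_congr rfl fun i _ => ?_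
  rw [lF, sT_iter]; simp only [sT]; congr 2; ring

lemma pot_neg (f : ℤ → ℝ × ℕ) (n : ℕ) :
    pot f (-n) = birkhoffSum sT' (fun f => - lF f) n f := by
  rw [pot, adiff_neg, birkhoffSum, ← Finset.sum_neg_distrib]
  refine Finset.sum_congr rfl fun i _ => ?_
  rw [lF, sT'_iter]; simp

lemma pot_neg1 (f : ℤ → ℝ × ℕ) (n : ℕ) :
    pot f (-n - 1) = birkhoffSum sT' (fun f => - lF f) (n + 1) f := by
  rw [← pot_neg]; congr 1; push_cast; ring

lemma birkhoff_neg (T : (ℤ → ℝ × ℕ) → (ℤ → ℝ × ℕ)) (Y : (ℤ → ℝ × ℕ) → ℝ) (n : ℕ) (f) :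
    birkhoffSum T (fun f => - Y f) n f = - birkhoffSum T Y n f := by
  simp [birkhoffSum]

/-- The summand of the right series. -/
def rS (f : ℤ → ℝ × ℕ) : Prop :=
  Summable fun n : ℕ => ((f (n + 1)).2 : ℝ) * Real.exp (pot f n)

/-- The summand of the left series. -/
def lS (f : ℤ → ℝ × ℕ) : Prop :=
  Summable fun n : ℕ => ((f (-n)).2 : ℝ) * Real.exp (pot f (-n - 1))

variable {Q : Measure (ℤ → ℝ × ℕ)} [IsProbabilityMeasure Q]

lemma erg' (h : Ergodic sT Q) : Ergodic sT' Q := Ergodic.symm (e := sE) h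

lemma not_atBot_of_lb {t : ℕ → ℝ} {m : ℝ} (h : ∀ n, m ≤ t n) : ¬ Tendsto t atTop atBot := by
  intro ht
  obtain ⟨n, hn⟩ := (ht.eventually_le_atBot (m - 1)).exists
  linarith [h n]

lemma right_sum (h : Ergodic sT Q) (hD : ∫⁻ f, ENNReal.ofReal (lD f) ∂Q ≠ ⊤)
    (hlt : ∫⁻ f, ENNReal.ofReal (lF f) ∂Q < ∫⁻ f, ENNReal.ofReal (-lF f) ∂Q) :
    ∀ᵐ f ∂Q, (∀ k, 1 ≤ (f k).2) → rS f := by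
  obtain ⟨c, hc, h1⟩ := ae_linear_decay h lF_meas hlt
  have h2 := ae_sublinear h.toMeasurePreserving lD_meas hD (half_pos hc)
  filter_upwards [h.quasiMeasurePreserving.ae h1, h.quasiMeasurePreserving.ae h2] with f ⟨M, hM⟩ h2 hd
  refine summable_of_decay hc (M := M) (fun n => ?_) (fun n => hd _) ?_
  · rw [pot_nat]; exact hM n
  · filter_upwards [h2] with n hn
    rw [lD, sT_iter] at hn
    simpa [sT] using hn

lemma right_not (h : Ergodic sT Q)
    (hlt : ∫⁻ f, ENNReal.ofReal (-lF f) ∂Q < ∫⁻ f, ENNReal.ofReal (lF f) ∂Q) :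
    ∀ᵐ f ∂Q, (∀ k, 1 ≤ (f k).2) → ¬ rS f := by
  obtain ⟨c, hc, h1⟩ := ae_linear_decay (Y := fun f => - lF f) h lF_meas.neg (by simpa using hlt)
  filter_upwards [h.quasiMeasurePreserving.ae h1] with f ⟨M, hM⟩ hd
  refine not_summable_of (fun n => hd _) (not_atBot_of_lb (m := -M) fun n => ?_)
  have := hM n
  rw [birkhoff_neg] at this
  rw [pot_nat]
  have : 0 ≤ c * (n : ℝ) := by positivity
  linarith

lemma left_sum (h : Ergodic sT Q) (hD : ∫⁻ f, ENNReal.ofReal (lD f) ∂Q ≠ ⊤)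
    (hlt : ∫⁻ f, ENNReal.ofReal (-lF f) ∂Q < ∫⁻ f, ENNReal.ofReal (lF f) ∂Q) :
    ∀ᵐ f ∂Q, (∀ k, 1 ≤ (f k).2) → lS f := by
  obtain ⟨c, hc, h1⟩ := ae_linear_decay (Y := fun f => - lF f) (erg' h) lF_meas.neg (by simpa using hlt)
  have h2 := ae_sublinear (erg' h).toMeasurePreserving lD_meas hD (half_pos hc)
  filter_upwards [h1, h2] with f ⟨M, hM⟩ h2 hd
  refine summable_of_decay hc (M := M - c) (fun n => ?_) (fun n => hd _) ?_
  · rw [pot_neg1]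
    have := hM (n + 1)
    push_cast at this
    linarith
  · filter_upwards [h2] with n hn
    rw [lD, sT'_iter] at hn
    simpa using hn

lemma left_not (h : Ergodic sT Q)
    (hlt : ∫⁻ f, ENNReal.ofReal (lF f) ∂Q < ∫⁻ f, ENNReal.ofReal (-lF f) ∂Q) :
    ∀ᵐ f ∂Q, (∀ k, 1 ≤ (f k).2) → ¬ lS f := by
  obtain ⟨c, hc, h1⟩ := ae_linear_decay (erg' h) lF_meas hlt
  filter_upwards [h1] with f ⟨M, hM⟩ hd
  refine not_summable_of (fun n => hd _) (not_atBot_of_lb (m := -M) fun n => ?_)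
  have := hM (n + 1)
  rw [pot_neg1, birkhoff_neg]
  have : 0 ≤ c * ((n + 1 : ℕ) : ℝ) := by positivity
  linarith

lemma both_not (h : Ergodic sT Q)
    (hfin : ∫⁻ f, ENNReal.ofReal (lF f) ∂Q ≠ ⊤ ∨ ∫⁻ f, ENNReal.ofReal (-lF f) ∂Q ≠ ⊤)
    (heq : ∫⁻ f, ENNReal.ofReal (lF f) ∂Q = ∫⁻ f, ENNReal.ofReal (-lF f) ∂Q) :
    ∀ᵐ f ∂Q, (∀ k, 1 ≤ (f k).2) → ¬ rS f ∧ ¬ lS f := by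
  have hp : ∫⁻ f, ENNReal.ofReal (lF f) ∂Q ≠ ⊤ := by
    rcases hfin with h | h
    · exact h
    · rwa [heq]
  have hn : ∫⁻ f, ENNReal.ofReal (-lF f) ∂Q ≠ ⊤ := heq ▸ hp
  have hint : Integrable lF Q := by
    refine ⟨lF_meas.aestronglyMeasurable, ?_⟩
    rw [hasFiniteIntegral_iff_norm]
    have : ∀ f, ENNReal.ofReal ‖lF f‖ = ENNReal.ofReal (lF f) + ENNReal.ofReal (-lF f) := by
      intro f
      rcases le_total 0 (lF f) with h | h
      · rw [Real.norm_of_nonneg h, ENNReal.ofReal_of_nonpos (p := -lF f) (by linarith), add_zero]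
      · rw [Real.norm_of_nonpos h, ENNReal.ofReal_of_nonpos h, zero_add]
    simp_rw [this]
    rw [lintegral_add_left lF_meas.ennreal_ofReal]
    exact ENNReal.add_lt_top.2 ⟨hp.lt_top, hn.lt_top⟩
  have h0 : ∫ f, lF f ∂Q = 0 := by
    rw [integral_eq_lintegral_pos_part_sub_lintegral_neg_part hint, heq, sub_self]
  have h1 := ae_not_atBot h lF_meas hint h0
  have h2 := ae_not_atBot (Y := fun f => - lF f) (erg' h) lF_meas.neg hint.neg
    (by rw [integral_neg, h0, neg_zero])
  filter_upwards [h.quasiMeasurePreserving.ae h1, h2] with f h1 h2 hd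
  refine ⟨not_summable_of (fun n => hd _) ?_, not_summable_of (fun n => hd _) ?_⟩
  · simpa only [pot_nat] using h1
  · simp only [pot_neg1]
    rwa [tendsto_add_atTop_iff_nat (f := fun n => birkhoffSum sT' (fun f => - lF f) n f) 1]

end FinalPart

/-- Theorem `rec-thm`: recurrence/transience criteria for a random walk
in a sparse random environment. -/
theorem statement0
    {Ω : Type*} [MeasurableSpace Ω] (P : Measure Ω) [IsProbabilityMeasure P]
    (lam : ℤ → Ω → ℝ) (d : ℤ → Ω → ℕ) (a : ℤ → Ω → ℤ)
    (hlam_meas : ∀ k, Measurable (lam k)) (hd_meas : ∀ k, Measurable (d k))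
    (hlam01 : ∀ k, ∀ᵐ ω ∂P, lam k ω ∈ Set.Ioo (0 : ℝ) 1)
    (hd_pos : ∀ k ω, 1 ≤ d k ω)
    (ha0 : ∀ ω, a 0 ω = 0)
    (ha_rec : ∀ ω, ∀ k : ℤ, a k ω - a (k - 1) ω = d k ω)
    -- (i) stationarity and ergodicity of the sequence of pairs `(d_n, λ_n)` under `P`
    (h_erg : Ergodic (fun f : ℤ → ℝ × ℕ => fun n => f (n + 1))
      (P.map fun ω => fun n : ℤ => (lam n ω, d n ω)))
    -- quenched law and annealed law
    (K : Kernel Ω (ℕ → ℤ)) [IsMarkovKernel K]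
    (hK : ∀ ω, IsQuenchedRW (sparseEnv (fun k => lam k ω) (fun k => a k ω)) 0 (K ω))
    -- (iii) `E_P (log d_0) < ∞`
    (hlogd : ∫⁻ ω, ENNReal.ofReal (Real.log (d 0 ω)) ∂P ≠ ⊤)
    -- (ii) `E_P (log ξ_0)` exists in `[-∞, ∞]`
    (hexists :
      (∫⁻ ω, ENNReal.ofReal (Real.log ((1 - lam 0 ω) / lam 0 ω)) ∂P ≠ ⊤) ∨
      (∫⁻ ω, ENNReal.ofReal (-Real.log ((1 - lam 0 ω) / lam 0 ω)) ∂P ≠ ⊤)) :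
    -- (a) `E_P (log ξ_0) < 0` implies `X_n → +∞` ℙ-a.s.
    ((∫⁻ ω, ENNReal.ofReal (Real.log ((1 - lam 0 ω) / lam 0 ω)) ∂P
        < ∫⁻ ω, ENNReal.ofReal (-Real.log ((1 - lam 0 ω) / lam 0 ω)) ∂P) →
      (∀ᵐ p ∂(P ⊗ₘ K), Tendsto (fun n => p.2 n) atTop atTop)) ∧
    -- (b) `E_P (log ξ_0) > 0` implies `X_n → -∞` ℙ-a.s.
    ((∫⁻ ω, ENNReal.ofReal (-Real.log ((1 - lam 0 ω) / lam 0 ω)) ∂P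
        < ∫⁻ ω, ENNReal.ofReal (Real.log ((1 - lam 0 ω) / lam 0 ω)) ∂P) →
      (∀ᵐ p ∂(P ⊗ₘ K), Tendsto (fun n => p.2 n) atTop atBot)) ∧
    -- (c) `E_P (log ξ_0) = 0` implies `liminf X_n = -∞` and `limsup X_n = +∞` ℙ-a.s.
    ((∫⁻ ω, ENNReal.ofReal (Real.log ((1 - lam 0 ω) / lam 0 ω)) ∂P
        = ∫⁻ ω, ENNReal.ofReal (-Real.log ((1 - lam 0 ω) / lam 0 ω)) ∂P) →
      (∀ᵐ p ∂(P ⊗ₘ K),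
        atTop.liminf (fun n => ((p.2 n : ℝ) : EReal)) = ⊥ ∧
        atTop.limsup (fun n => ((p.2 n : ℝ) : EReal)) = ⊤)) := by
  set Φ : Ω → ℤ → ℝ × ℕ := fun ω => fun n : ℤ => (lam n ω, d n ω) with hΦdef
  have hΦ : Measurable Φ := measurable_pi_lambda _ fun n => (hlam_meas n).prodMk (hd_meas n)
  set Q := P.map Φ with hQ
  haveI : IsProbabilityMeasure Q := Measure.isProbabilityMeasure_map hΦ.aemeasurable
  have herg : Ergodic sT Q := h_erg
  have e1 : ∫⁻ f, ENNReal.ofReal (lF f) ∂Q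
      = ∫⁻ ω, ENNReal.ofReal (Real.log ((1 - lam 0 ω) / lam 0 ω)) ∂P :=
    lintegral_map lF_meas.ennreal_ofReal hΦ
  have e2 : ∫⁻ f, ENNReal.ofReal (-lF f) ∂Q
      = ∫⁻ ω, ENNReal.ofReal (-Real.log ((1 - lam 0 ω) / lam 0 ω)) ∂P :=
    lintegral_map lF_meas.neg.ennreal_ofReal hΦ
  have e3 : ∫⁻ f, ENNReal.ofReal (lD f) ∂Q
      = ∫⁻ ω, ENNReal.ofReal (Real.log (d 0 ω)) ∂P :=
    lintegral_map lD_meas.ennreal_ofReal hΦ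
  rw [← e3] at hlogd
  simp only [← e1, ← e2] at hexists ⊢
  have hall : ∀ᵐ ω ∂P, ∀ k, lam k ω ∈ Set.Ioo (0 : ℝ) 1 := ae_all_iff.2 hlam01
  have hX : ∀ n : ℕ, Measurable fun p : Ω × (ℕ → ℤ) => p.2 n := fun n =>
    (measurable_pi_apply n).comp measurable_snd
  have hXE : ∀ n : ℕ, Measurable fun p : Ω × (ℕ → ℤ) => (((p.2 n : ℤ) : ℝ) : EReal) := fun n =>
    (measurable_from_top (f := fun z : ℤ => ((z : ℝ) : EReal))).comp (hX n)
  refine ⟨fun hlt => ?_, fun hlt => ?_, fun heq => ?_⟩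
  · refine Measure.ae_compProd_of_ae_ae (measurableSet_tendsto _ hX) ?_
    filter_upwards [hall, ae_of_ae_map hΦ.aemeasurable (right_sum herg hlogd hlt),
      ae_of_ae_map hΦ.aemeasurable (left_not herg hlt)] with ω hl hr hle
    have hr := hr fun k => hd_pos k ω
    have hle := hle fun k => hd_pos k ω
    obtain ⟨h, hm, harm, h0, hH⟩ := exists_scale hl (fun k => hd_pos k ω) (ha0 ω) (ha_rec ω)
    exact chain_right (sparse_mem hl) (hK ω) h harm hm (left_bot hm h0 (ha0 ω) hH hle)
      (right_bdd hm h0 (ha0 ω) (fun k => hd_pos k ω) (ha_rec ω) hH hr)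
  · refine Measure.ae_compProd_of_ae_ae (measurableSet_tendsto _ hX) ?_
    filter_upwards [hall, ae_of_ae_map hΦ.aemeasurable (left_sum herg hlogd hlt),
      ae_of_ae_map hΦ.aemeasurable (right_not herg hlt)] with ω hl hle hr
    have hr := hr fun k => hd_pos k ω
    have hle := hle fun k => hd_pos k ω
    obtain ⟨h, hm, harm, h0, hH⟩ := exists_scale hl (fun k => hd_pos k ω) (ha0 ω) (ha_rec ω)
    exact chain_left (sparse_mem hl) (hK ω) h harm hm (right_top hm h0 (ha0 ω) hH hr)
      (left_bdd hm h0 (ha0 ω) (fun k => hd_pos k ω) (ha_rec ω) hH hle)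
  · refine Measure.ae_compProd_of_ae_ae ?_ ?_
    · exact (measurableSet_eq_fun (Measurable.liminf hXE) measurable_const).inter
        (measurableSet_eq_fun (Measurable.limsup hXE) measurable_const)
    filter_upwards [hall, ae_of_ae_map hΦ.aemeasurable (both_not herg hexists heq)] with ω hl hb
    obtain ⟨hr, hle⟩ := hb fun k => hd_pos k ω
    obtain ⟨h, hm, harm, h0, hH⟩ := exists_scale hl (fun k => hd_pos k ω) (ha0 ω) (ha_rec ω)
    filter_upwards [chain_sup (sparse_mem hl) (hK ω) h harm hm (left_bot hm h0 (ha0 ω) hH hle),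
      chain_inf (sparse_mem hl) (hK ω) h harm hm (right_top hm h0 (ha0 ω) hH hr)] with f h1 h2
    exact ⟨liminf_bot h2, limsup_top h1⟩
end
end

section
/- Suppose that (d_n, λ_n)_{n∈ℤ} is stationary and ergodic under P with (d_n)_{n∈ℤ} independent of (λ_n)_{n∈ℤ}, E_P(log ξ_0) exists, E_P(log d_0) < ∞, E_P(d_0) < ∞, and the random walk is transient to the right: lim_{n→∞} X_n = +∞ ℙ-almost surely. Let v_P ∈ (0,1) be the ℙ-a.s. limit of X_n/n. Then v_P = 1 / E_Q(S̃), where S̃ = Σ_{i=1}^∞ (1+ρ̃_{−i}) ∏_{j=0}^{i−1} ρ̃_{−j} + 1 + ρ̃_0. -/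
open MeasureTheory ProbabilityTheory Filter Set
open scoped ENNReal NNReal Topology

noncomputable section

/-- `ρ_n = (1 - ω_n)/ω_n` for an environment `ω`. -/
def rhoOf (env : ℤ → ℝ) (n : ℤ) : ℝ := (1 - env n) / env n

/-- `S̃ = Σ_{i=1}^∞ (1 + ρ̃_{-i}) ∏_{j=0}^{i-1} ρ̃_{-j} + 1 + ρ̃_0`, as a value in `[0,∞]`. -/
def Stilde (rho : ℤ → ℝ) : ℝ≥0∞ :=
  (∑' i : ℕ, (1 + ENNReal.ofReal (rho (-(i + 1 : ℕ) : ℤ)))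
      * ∏ j ∈ Finset.range (i + 1), ENNReal.ofReal (rho (-(j : ℤ))))
    + 1 + ENNReal.ofReal (rho 0)

/-! ### Numerical part: expected truncated hitting times -/

/-- `eN p q y n x` is the expectation of `min (T_y) n` for the walk started at `x`. -/
def eN (p q : ℤ → ℝ≥0∞) (y : ℤ) : ℕ → ℤ → ℝ≥0∞
  | 0, _ => 0
  | n + 1, x => if x = y then 0 else 1 + p x * eN p q y n (x + 1) + q x * eN p q y n (x - 1)

lemma eN_self (p q : ℤ → ℝ≥0∞) (y : ℤ) (n : ℕ) : eN p q y n y = 0 := by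
  cases n <;> simp [eN]

lemma eN_succ (p q : ℤ → ℝ≥0∞) (y : ℤ) (n : ℕ) {x : ℤ} (h : x ≠ y) :
    eN p q y (n + 1) x = 1 + p x * eN p q y n (x + 1) + q x * eN p q y n (x - 1) := by
  simp [eN, h]

lemma eN_shift (p q : ℤ → ℝ≥0∞) (y c : ℤ) (n : ℕ) (x : ℤ) :
    eN (fun z => p (z + c)) (fun z => q (z + c)) y n x = eN p q (y + c) n (x + c) := by
  induction n generalizing x with
  | zero => simp [eN]
  | succ n ih =>
    by_cases h : x = y
    · subst h; simp [eN_self]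
    · rw [eN_succ _ _ _ _ h, eN_succ _ _ _ _ (by simpa using h), ih, ih,
        add_right_comm x 1 c, sub_add_eq_add_sub x 1 c]

lemma eN_mono_succ (p q : ℤ → ℝ≥0∞) (y : ℤ) (n : ℕ) (x : ℤ) :
    eN p q y n x ≤ eN p q y (n + 1) x := by
  induction n generalizing x with
  | zero => simp [eN]
  | succ n ih =>
    by_cases h : x = y
    · subst h; simp [eN_self]
    · rw [eN_succ _ _ _ _ h, eN_succ _ _ _ _ h]
      gcongr <;> exact ih _

lemma eN_mono (p q : ℤ → ℝ≥0∞) (y : ℤ) (x : ℤ) : Monotone (fun n => eN p q y n x) :=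
  monotone_nat_of_le_succ (fun n => eN_mono_succ p q y n x)

lemma eN_le_succ (p q : ℤ → ℝ≥0∞) (hpq : ∀ x, p x + q x = 1) (y : ℤ) (n : ℕ) (x : ℤ) :
    eN p q y (n + 1) x ≤ 1 + eN p q y n x := by
  induction n generalizing x with
  | zero =>
    by_cases h : x = y
    · subst h; simp [eN_self]
    · rw [eN_succ _ _ _ _ h]; simp [eN]
  | succ n ih =>
    by_cases h : x = y
    · subst h; simp [eN_self]
    · rw [eN_succ _ _ _ _ h, eN_succ p q y n h]
      calc 1 + p x * eN p q y (n + 1) (x + 1) + q x * eN p q y (n + 1) (x - 1)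
          ≤ 1 + p x * (1 + eN p q y n (x + 1)) + q x * (1 + eN p q y n (x - 1)) := by
            gcongr <;> exact ih _
        _ = 1 + ((p x + q x) + p x * eN p q y n (x + 1) + q x * eN p q y n (x - 1)) := by ring
        _ = _ := by rw [hpq]

lemma eN_anti (p q : ℤ → ℝ≥0∞) (hpq : ∀ x, p x + q x = 1) (y : ℤ) (n : ℕ) (x : ℤ) (hx : x < y) :
    eN p q y n (x + 1) ≤ eN p q y n x := by
  induction n generalizing x with
  | zero => simp [eN]
  | succ n ih =>
    by_cases h : x + 1 = y
    · subst h; simp [eN_self]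
    · calc eN p q y (n + 1) (x + 1) ≤ 1 + eN p q y n (x + 1) := eN_le_succ p q hpq _ _ _
        _ = 1 + (p x + q x) * eN p q y n (x + 1) := by rw [hpq, one_mul]
        _ = 1 + p x * eN p q y n (x + 1) + q x * eN p q y n (x + 1) := by ring
        _ ≤ 1 + p x * eN p q y n (x + 1) + q x * eN p q y n (x - 1) := by
            gcongr
            calc eN p q y n (x + 1) ≤ eN p q y n x := ih x hx
              _ = eN p q y n (x - 1 + 1) := by rw [sub_add_cancel]
              _ ≤ _ := ih (x - 1) (by omega)
        _ = _ := by rw [eN_succ _ _ _ _ hx.ne]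

/-- Limit of the truncated expectations. -/
def eI (p q : ℤ → ℝ≥0∞) (y x : ℤ) : ℝ≥0∞ := ⨆ n, eN p q y n x

lemma eI_self (p q : ℤ → ℝ≥0∞) (y : ℤ) : eI p q y y = 0 := by simp [eI, eN_self]

lemma eI_eq (p q : ℤ → ℝ≥0∞) (y x : ℤ) (h : x ≠ y) :
    1 + p x * eI p q y (x + 1) + q x * eI p q y (x - 1) ≤ eI p q y x := by
  unfold eI
  rw [ENNReal.mul_iSup, ENNReal.mul_iSup, add_assoc, ENNReal.iSup_add_iSup_of_monotone, 
    ENNReal.add_iSup]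
  · refine iSup_le fun n => le_iSup_of_le (n + 1) ?_
    rw [eN_succ _ _ _ _ h, add_assoc]
  · intro a b hab
    exact mul_le_mul_right (eN_mono _ _ _ _ hab) _
  · intro a b hab
    exact mul_le_mul_right (eN_mono _ _ _ _ hab) _

/-- Upper bound by any supersolution. -/
lemma eN_le (p q S : ℤ → ℝ≥0∞) (hpq : ∀ x, p x + q x = 1)
    (hS : ∀ x, p x * S x = 1 + q x * S (x - 1)) (y : ℤ) (n : ℕ) (m : ℕ) :
    eN p q y n (y - m) ≤ ∑ i ∈ Finset.range m, S (y - (i + 1 : ℕ)) := by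
  induction n generalizing m with
  | zero => simp [eN]
  | succ n ih =>
    cases m with
    | zero => simp [eN_self]
    | succ m =>
      rw [eN_succ _ _ _ _ (by push_cast; omega)]
      have h1 := ih m
      have h2 := ih (m + 2)
      set x : ℤ := y - (m + 1 : ℕ) with hx
      have e1 : x + 1 = y - m := by rw [hx]; push_cast; ring
      have e2 : x - 1 = y - (m + 2 : ℕ) := by rw [hx]; push_cast; ring
      rw [Finset.sum_range_succ, Finset.sum_range_succ, ← hx, ← e2] at h2
      rw [Finset.sum_range_succ, ← hx, e1]
      calc 1 + p x * eN p q y n (y - m) + q x * eN p q y n (x - 1)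
          ≤ 1 + p x * (∑ i ∈ Finset.range m, S (y - (i + 1 : ℕ)))
            + q x * (∑ i ∈ Finset.range m, S (y - (i + 1 : ℕ)) + S x + S (x - 1)) := by gcongr
        _ = (p x + q x) * (∑ i ∈ Finset.range m, S (y - (i + 1 : ℕ))) + q x * S x
              + (1 + q x * S (x - 1)) := by ring
        _ = (p x + q x) * (∑ i ∈ Finset.range m, S (y - (i + 1 : ℕ))) + (p x + q x) * S x := by
            rw [← hS]; ring
        _ = _ := by rw [hpq, one_mul, one_mul]

/-- Truncated series. -/
def Sn (r : ℤ → ℝ≥0∞) : ℕ → ℤ → ℝ≥0∞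
  | 0, _ => 0
  | n + 1, x => 1 + r x + r x * Sn r n (x - 1)

lemma eI_ge_step (p q r : ℤ → ℝ≥0∞) (hpq : ∀ x, p x + q x = 1) (hp : ∀ x, p x ≠ 0)
    (hr : ∀ x, p x * r x = q x) (y : ℤ) (n : ℕ) (x : ℤ) (hx : x < y) :
    eI p q y (x + 1) + Sn r n x ≤ eI p q y x := by
  induction n generalizing x with
  | zero =>
    simp only [Sn, add_zero]
    exact iSup_mono fun n => eN_anti p q hpq y n x hx
  | succ n ih =>
    by_cases ht : eI p q y x = ⊤
    · rw [ht]; exact le_top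
    have h1 := eI_eq p q y x hx.ne
    have h2 := ih (x - 1) (by omega)
    rw [sub_add_cancel] at h2
    have hp1 : p x ≠ ⊤ := by
      intro h; have := hpq x; rw [h] at this; simp at this
    have hq1 : q x ≠ ⊤ := by
      intro h; have := hpq x; rw [h] at this; simp at this
    have h3 : p x * (eI p q y (x + 1) + Sn r (n + 1) x) + q x * eI p q y x
        ≤ p x * eI p q y x + q x * eI p q y x := by
      rw [← add_mul, hpq, one_mul]
      refine le_trans ?_ h1
      have : p x * (eI p q y (x + 1) + Sn r (n + 1) x)
        = p x * eI p q y (x + 1) + ((p x + p x * r x) + (p x * r x) * Sn r n (x - 1)) := by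
        simp only [Sn]; ring
      rw [this, hr, hpq]
      calc _ = 1 + p x * eI p q y (x + 1) + q x * (eI p q y x + Sn r n (x - 1)) := by ring
        _ ≤ _ := by gcongr
    have h4 := (ENNReal.add_le_add_iff_right (ENNReal.mul_ne_top hq1 ht)).1 h3
    exact (ENNReal.mul_le_mul_iff_right (hp x) hp1).1 h4

lemma Sn_succ_eq (r : ℤ → ℝ≥0∞) (n : ℕ) (x : ℤ) :
    Sn r (n + 1) x = (∑ i ∈ Finset.range n, (1 + r (x - (i + 1 : ℕ)))
      * ∏ j ∈ Finset.range (i + 1), r (x - j)) + 1 + r x := by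
  induction n generalizing x with
  | zero => simp [Sn]
  | succ n ih =>
    rw [Sn, ih, Finset.sum_range_succ']
    have : ∀ i ∈ Finset.range n, (1 + r (x - (i + 1 + 1 : ℕ)))
        * ∏ j ∈ Finset.range (i + 1 + 1), r (x - j)
        = r x * ((1 + r (x - 1 - (i + 1 : ℕ))) * ∏ j ∈ Finset.range (i + 1), r (x - 1 - j)) := by
      intro i _
      rw [Finset.prod_range_succ']
      have e : ∀ k : ℕ, x - 1 - (k : ℤ) = x - (k + 1 : ℕ) := by intro k; push_cast; ring
      simp only [e, Nat.cast_zero, sub_zero]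
      ring
    rw [Finset.sum_congr rfl this, ← Finset.mul_sum]
    simp
    ring

/-- `Stilde` of the environment seen from `x`. -/
def Sx (rho : ℤ → ℝ) (x : ℤ) : ℝ≥0∞ := Stilde (fun n => rho (n + x))

lemma Sx_eq_iSup (rho : ℤ → ℝ) (x : ℤ) :
    Sx rho x = ⨆ n, Sn (fun z => ENNReal.ofReal (rho z)) (n + 1) x := by
  unfold Sx Stilde
  rw [ENNReal.tsum_eq_iSup_nat, ENNReal.iSup_add, ENNReal.iSup_add]
  congr 1
  ext n
  rw [Sn_succ_eq]
  have e : ∀ k : ℕ, -(k : ℤ) + x = x - k := by intro k; ring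
  simp only [e, zero_add]

lemma Sn_mono (r : ℤ → ℝ≥0∞) (n : ℕ) (x : ℤ) : Sn r n x ≤ Sn r (n + 1) x := by
  induction n generalizing x with
  | zero => simp [Sn]
  | succ n ih =>
    rw [Sn, Sn]
    gcongr
    exact ih _

lemma Sx_rec (rho : ℤ → ℝ) (x : ℤ) :
    Sx rho x = 1 + ENNReal.ofReal (rho x) + ENNReal.ofReal (rho x) * Sx rho (x - 1) := by
  rw [Sx_eq_iSup, Sx_eq_iSup, ENNReal.mul_iSup, ENNReal.add_iSup]
  apply le_antisymm
  · refine iSup_le fun n => le_iSup_of_le n ?_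
    rw [Sn]
    gcongr
    exact Sn_mono _ _ _
  · refine iSup_le fun n => le_iSup_of_le (n + 1) ?_
    exact le_of_eq rfl

lemma eI_eq_sum (env : ℤ → ℝ) (henv : ∀ x, env x ∈ Set.Ioo (0 : ℝ) 1) (y : ℤ) (m : ℕ) :
    eI (fun x => ENNReal.ofReal (env x)) (fun x => ENNReal.ofReal (1 - env x)) y (y - m)
      = ∑ i ∈ Finset.range m, Sx (rhoOf env) (y - (i + 1 : ℕ)) := by
  have hpq : ∀ x, ENNReal.ofReal (env x) + ENNReal.ofReal (1 - env x) = 1 := by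
    intro x
    rw [← ENNReal.ofReal_add (henv x).1.le (by linarith [(henv x).2])]
    simp
  have hp : ∀ x, ENNReal.ofReal (env x) ≠ 0 := by
    intro x; simpa using (henv x).1
  have hr : ∀ x, ENNReal.ofReal (env x) * ENNReal.ofReal (rhoOf env x)
      = ENNReal.ofReal (1 - env x) := by
    intro x
    rw [← ENNReal.ofReal_mul (henv x).1.le, rhoOf, mul_div_cancel₀ _ (henv x).1.ne']
  apply le_antisymm
  · refine iSup_le fun n => eN_le _ _ (Sx (rhoOf env)) hpq ?_ y n m
    intro x
    rw [Sx_rec, mul_add, mul_add, mul_one, ← mul_assoc, hr, hpq]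
  · induction m with
    | zero => simp
    | succ m ih =>
      rw [Finset.sum_range_succ]
      have e1 : y - (m : ℤ) = y - (m + 1 : ℕ) + 1 := by push_cast; ring
      rw [e1] at ih
      refine le_trans (add_le_add_left ih _) ?_
      rw [Sx_eq_iSup, ENNReal.add_iSup]
      refine iSup_le fun n => ?_
      exact eI_ge_step _ _ (fun z => ENNReal.ofReal (rhoOf env z)) hpq hp hr y _ _
        (by push_cast; omega)

/-! ### The comparison lemma -/

lemma compare_aux {α : Type*} [MeasurableSpace α] (μ : Measure α) [IsProbabilityMeasure μ]
    (A B : ℕ → α → ℝ≥0∞) (hA : ∀ k, Measurable (A k)) (hB : ∀ k, Measurable (B k))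
    (hAs : ∀ (k N : ℕ), ∫⁻ x, min (A k x) N ∂μ = ∫⁻ x, min (A 0 x) N ∂μ)
    (hBs : ∀ k, ∫⁻ x, B k x ∂μ = ∫⁻ x, B 0 x ∂μ)
    (hAt : ∀ x, A 0 x ≠ ⊤) (c : ℝ≥0∞)
    (h : ∀ᵐ x ∂μ, ∀ᶠ n in atTop,
      ∑ k ∈ Finset.range n, A k x ≤ c * ∑ k ∈ Finset.range n, B k x) :
    ∫⁻ x, A 0 x ∂μ ≤ c * ∫⁻ x, B 0 x ∂μ := by
  have hmA : ∀ n, Measurable fun x => ∑ k ∈ Finset.range n, A k x :=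
    fun n => Finset.measurable_sum _ fun k _ => hA k
  have hmB : ∀ n, Measurable fun x => ∑ k ∈ Finset.range n, B k x :=
    fun n => Finset.measurable_sum _ fun k _ => hB k
  set bad : ℕ → Set α := fun n =>
    {x | c * ∑ k ∈ Finset.range n, B k x < ∑ k ∈ Finset.range n, A k x} with hbad
  have hbm : ∀ n, MeasurableSet (bad n) := fun n =>
    measurableSet_lt ((hmB n).const_mul c) (hmA n)
  have hlim : Tendsto (fun n => μ (bad n)) atTop (𝓝 0) := by
    have := tendsto_measure_of_ae_tendsto_indicator_of_isFiniteMeasure (μ := μ) atTop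
      (A := ∅) MeasurableSet.empty hbm (by
        filter_upwards [h] with x hx
        filter_upwards [hx] with n hn
        simp [hbad, hn])
    simpa using this
  have key : ∀ N : ℕ, ∫⁻ x, min (A 0 x) N ∂μ ≤ c * ∫⁻ x, B 0 x ∂μ := by
    intro N
    have h1 : ∀ n : ℕ, 1 ≤ n →
        ∫⁻ x, min (A 0 x) N ∂μ ≤ c * ∫⁻ x, B 0 x ∂μ + N * μ (bad n) := by
      intro n hn
      have hn0 : (n : ℝ≥0∞) ≠ 0 := by simp; omega
      refine (ENNReal.mul_le_mul_iff_right hn0 (ENNReal.natCast_ne_top n)).1 ?_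
      calc (n : ℝ≥0∞) * ∫⁻ x, min (A 0 x) N ∂μ
          = ∑ k ∈ Finset.range n, ∫⁻ x, min (A k x) N ∂μ := by
            rw [Finset.sum_congr rfl (fun k _ => hAs k N)]; simp
        _ = ∫⁻ x, ∑ k ∈ Finset.range n, min (A k x) N ∂μ := by
            rw [lintegral_finsetSum]
            exact fun k _ => (hA k).min measurable_const
        _ ≤ ∫⁻ x, (c * ∑ k ∈ Finset.range n, B k x
              + (bad n).indicator (fun _ => (n : ℝ≥0∞) * N) x) ∂μ := by
            refine lintegral_mono fun x => ?_
            by_cases hx : x ∈ bad n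
            · rw [Set.indicator_of_mem hx]
              refine le_trans ?_ le_add_self
              calc _ ≤ ∑ k ∈ Finset.range n, (N : ℝ≥0∞) :=
                    Finset.sum_le_sum fun k _ => min_le_right _ _
                _ = _ := by simp
            · rw [Set.indicator_of_notMem hx, add_zero]
              have hx' : ∑ k ∈ Finset.range n, A k x ≤ c * ∑ k ∈ Finset.range n, B k x := by
                simpa [hbad] using hx
              exact le_trans (Finset.sum_le_sum fun k _ => min_le_left _ _) hx'
        _ = c * ∑ k ∈ Finset.range n, ∫⁻ x, B k x ∂μ + n * N * μ (bad n) := by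
            rw [lintegral_add_left ((hmB n).const_mul c), lintegral_const_mul _ (hmB n),
              lintegral_finsetSum _ fun k _ => hB k, lintegral_indicator_const (hbm n)]
        _ = _ := by
            rw [Finset.sum_congr rfl (fun k _ => hBs k)]
            simp only [Finset.sum_const, Finset.card_range, nsmul_eq_mul]
            ring
    have h2 : Tendsto (fun n => c * ∫⁻ x, B 0 x ∂μ + N * μ (bad n)) atTop
        (𝓝 (c * ∫⁻ x, B 0 x ∂μ + N * 0)) :=
      Tendsto.add tendsto_const_nhds
        (ENNReal.Tendsto.const_mul hlim (Or.inr (ENNReal.natCast_ne_top N)))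
    rw [mul_zero, add_zero] at h2
    exact ge_of_tendsto h2 (eventually_atTop.2 ⟨1, h1⟩)
  have hsup : ∀ x, A 0 x = ⨆ N : ℕ, min (A 0 x) N := by
    intro x
    apply le_antisymm
    · obtain ⟨N, hN⟩ := ENNReal.exists_nat_gt (hAt x)
      exact le_iSup_of_le N (le_min le_rfl hN.le)
    · exact iSup_le fun N => min_le_left _ _
  rw [lintegral_congr hsup, lintegral_iSup]
  · exact iSup_le key
  · exact fun N => (hA 0).min measurable_const
  · intro i j hij x
    exact min_le_min_left _ (by exact_mod_cast hij)

/-! ### Markov property -/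

/-- `D` depends only on the coordinates up to time `s`. -/
def Det (D : Set (ℕ → ℤ)) (s : ℕ) : Prop :=
  ∀ f g : ℕ → ℤ, (∀ k ≤ s, f k = g k) → f ∈ D → g ∈ D

/-- restriction to the first coordinates -/
def prj (s : ℕ) (f : ℕ → ℤ) : Fin (s + 1) → ℤ := fun i => f i

lemma measurable_prj (s : ℕ) : Measurable (prj s) :=
  measurable_pi_lambda _ fun _ => measurable_pi_apply _

lemma prj_eq_iff (s : ℕ) (f g : ℕ → ℤ) : prj s f = prj s g ↔ ∀ k ≤ s, f k = g k := by
  constructor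
  · intro h k hk
    exact congrFun h ⟨k, by omega⟩
  · intro h
    ext i
    exact h i (by omega)

lemma Det.measurableSet {D : Set (ℕ → ℤ)} {s : ℕ} (h : Det D s) : MeasurableSet D := by
  have : D = prj s ⁻¹' (prj s '' D) := by
    apply Set.Subset.antisymm (Set.subset_preimage_image _ _)
    rintro g ⟨f, hf, hfg⟩
    exact h f g ((prj_eq_iff s f g).1 hfg) hf
  rw [this]
  exact measurable_prj s (Set.to_countable _).measurableSet

lemma stepProb_nonneg {env : ℤ → ℝ} (henv : ∀ x, env x ∈ Set.Ioo (0 : ℝ) 1) (x z : ℤ) :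
    0 ≤ stepProb env x z := by
  unfold stepProb
  split_ifs
  · exact (henv x).1.le
  · linarith [(henv x).2]
  · rfl

lemma start_ae {env : ℤ → ℝ} {μ : Measure (ℕ → ℤ)} (h : IsQuenchedRW env 0 μ) :
    ∀ᵐ f ∂μ, f 0 = 0 := by
  have := h.1
  have h1 := h.2 0 (fun _ => 0) rfl
  simp only [Finset.range_zero, Finset.prod_empty, ENNReal.ofReal_one] at h1
  have h2 : {f : ℕ → ℤ | ∀ k ≤ 0, f k = 0} = {f | f 0 = 0} := by
    ext f; simp
  rw [h2] at h1
  have hm : MeasurableSet {f : ℕ → ℤ | f 0 = 0} := measurable_pi_apply 0 (measurableSet_singleton 0)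
  exact (prob_compl_eq_zero_iff hm).2 h1

lemma markov_cyl {env : ℤ → ℝ} (henv : ∀ x, env x ∈ Set.Ioo (0 : ℝ) 1) {μ : Measure (ℕ → ℤ)}
    (h : IsQuenchedRW env 0 μ) (s : ℕ) (f : ℕ → ℤ) (z : ℤ) :
    μ ({g | ∀ k ≤ s, g k = f k} ∩ {g | g (s + 1) = z})
      = ENNReal.ofReal (stepProb env (f s) z) * μ {g | ∀ k ≤ s, g k = f k} := by
  by_cases h0 : f 0 = 0
  · have e : {g : ℕ → ℤ | ∀ k ≤ s, g k = f k} ∩ {g | g (s + 1) = z}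
        = {g | ∀ k ≤ s + 1, g k = Function.update f (s + 1) z k} := by
      ext g
      simp only [Set.mem_inter_iff, Set.mem_ofPred_eq]
      constructor
      · rintro ⟨h1, h2⟩ k hk
        rcases Nat.lt_or_ge s k with hlt | hge
        · obtain rfl : k = s + 1 := by omega
          simpa using h2
        · rw [Function.update_of_ne (by omega)]; exact h1 k hge
      · intro h1
        refine ⟨fun k hk => ?_, ?_⟩
        · have := h1 k (by omega)
          rwa [Function.update_of_ne (by omega)] at this
        · simpa using h1 (s + 1) le_rfl
    rw [e, h.2 _ _ (by rw [Function.update_of_ne (by omega)]; exact h0), h.2 _ _ h0,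
      ← ENNReal.ofReal_mul (stepProb_nonneg henv _ _), Finset.prod_range_succ, mul_comm]
    congr 2
    · rw [Function.update_of_ne (by omega), Function.update_self]
    · refine Finset.prod_congr rfl fun k hk => ?_
      have := Finset.mem_range.1 hk
      rw [Function.update_of_ne (by omega), Function.update_of_ne (by omega)]
  · have hz : μ {g : ℕ → ℤ | ∀ k ≤ s, g k = f k} = 0 := by
      refine measure_mono_null ?_ (start_ae h)
      intro g hg hg0
      exact h0 ((hg 0 (Nat.zero_le _)).symm.trans hg0)
    rw [hz, mul_zero]
    exact measure_mono_null Set.inter_subset_left hz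

lemma markov_step {env : ℤ → ℝ} (henv : ∀ x, env x ∈ Set.Ioo (0 : ℝ) 1) {μ : Measure (ℕ → ℤ)}
    (h : IsQuenchedRW env 0 μ) {D : Set (ℕ → ℤ)} {s : ℕ} {x : ℤ} (hD : Det D s)
    (hx : ∀ f ∈ D, f s = x) (z : ℤ) :
    μ (D ∩ {g | g (s + 1) = z}) = ENNReal.ofReal (stepProb env x z) * μ D := by
  have key : (μ.restrict (D ∩ {g | g (s + 1) = z})).map (prj s)
      = ENNReal.ofReal (stepProb env x z) • (μ.restrict D).map (prj s) := by
    refine Measure.ext_of_singleton fun c => ?_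
    rw [Measure.smul_apply, Measure.map_apply (measurable_prj s) (measurableSet_singleton c),
      Measure.map_apply (measurable_prj s) (measurableSet_singleton c),
      Measure.restrict_apply (measurable_prj s (measurableSet_singleton c)),
      Measure.restrict_apply (measurable_prj s (measurableSet_singleton c)), smul_eq_mul]
    by_cases he : ∃ f ∈ D, prj s f = c
    · obtain ⟨f, hf, rfl⟩ := he
      have e1 : prj s ⁻¹' {prj s f} = {g | ∀ k ≤ s, g k = f k} := by
        ext g
        exact prj_eq_iff s g f
      have e2 : {g : ℕ → ℤ | ∀ k ≤ s, g k = f k} ⊆ D := by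
        intro g hg
        exact hD f g (fun k hk => (hg k hk).symm) hf
      rw [e1, ← Set.inter_assoc, Set.inter_eq_left.2 e2, markov_cyl henv h, hx f hf]
    · have : prj s ⁻¹' {c} ∩ D = ∅ := by
        ext g
        simp only [Set.mem_inter_iff, Set.mem_preimage, Set.mem_singleton_iff,
          Set.mem_empty_iff_false, iff_false]
        rintro ⟨h1, h2⟩
        exact he ⟨g, h2, h1⟩
      rw [← Set.inter_assoc, this]
      simp
  have := congrArg (fun m => m Set.univ) key
  simpa [Measure.map_apply (measurable_prj s) MeasurableSet.univ] using this

lemma step_ae {env : ℤ → ℝ} (henv : ∀ x, env x ∈ Set.Ioo (0 : ℝ) 1) {μ : Measure (ℕ → ℤ)}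
    (h : IsQuenchedRW env 0 μ) :
    ∀ᵐ f ∂μ, ∀ s, f (s + 1) = f s + 1 ∨ f (s + 1) = f s - 1 := by
  rw [ae_all_iff]
  intro s
  have h1 : ∀ x z : ℤ, ∀ᵐ f ∂μ, f s = x → f (s + 1) = z → (z = x + 1 ∨ z = x - 1) := by
    intro x z
    by_cases hz : z = x + 1 ∨ z = x - 1
    · exact Eventually.of_forall fun _ _ _ => hz
    · push Not at hz
      have := markov_step henv h (D := {f | f s = x}) (s := s) (x := x)
        (fun f g hfg hf => by
          have := hfg s le_rfl
          simp only [Set.mem_ofPred_eq] at hf ⊢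
          omega) (fun f hf => hf) z
      have h0 : stepProb env x z = 0 := by simp [stepProb, hz.1, hz.2]
      rw [h0, ENNReal.ofReal_zero, zero_mul] at this
      refine measure_mono_null ?_ this
      intro f hf
      by_contra hc
      apply hf
      intro h1 h2
      exact absurd ⟨h1, h2⟩ hc
  have h2 : ∀ᵐ f ∂μ, ∀ x z : ℤ, f s = x → f (s + 1) = z → (z = x + 1 ∨ z = x - 1) := by
    rw [ae_all_iff]; intro x; rw [ae_all_iff]; exact h1 x
  filter_upwards [h2] with f hf
  exact hf _ _ rfl rfl

/-- Truncated hitting time of `y` after time `s`. -/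
def mN (y : ℤ) : ℕ → ℕ → (ℕ → ℤ) → ℝ≥0∞
  | 0, _, _ => 0
  | n + 1, s, f => if f s = y then 0 else 1 + mN y n (s + 1) f

lemma measurable_mN (y : ℤ) (n s : ℕ) : Measurable (mN y n s) := by
  induction n generalizing s with
  | zero => exact measurable_const
  | succ n ih =>
    refine Measurable.ite ?_ measurable_const (measurable_const.add (ih (s + 1)))
    have hm : MeasurableSet {f : ℕ → ℤ | f s = y} :=
      measurableSet_eq_fun (measurable_pi_apply s) measurable_const
    exact hm

lemma lintegral_mN {env : ℤ → ℝ} (henv : ∀ x, env x ∈ Set.Ioo (0 : ℝ) 1) {μ : Measure (ℕ → ℤ)}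
    (h : IsQuenchedRW env 0 μ) (y : ℤ) (n : ℕ) {D : Set (ℕ → ℤ)} {s : ℕ} {x : ℤ} (hD : Det D s)
    (hx : ∀ f ∈ D, f s = x) :
    ∫⁻ f in D, mN y n s f ∂μ = μ D *
      eN (fun x => ENNReal.ofReal (env x)) (fun x => ENNReal.ofReal (1 - env x)) y n x := by
  have := h.1
  induction n generalizing D s x with
  | zero => simp [mN, eN]
  | succ n ih =>
    by_cases hxy : x = y
    · subst hxy
      rw [eN_self, mul_zero, setLIntegral_congr_fun (g := fun _ => 0) hD.measurableSet]
      · simp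
      · intro f hf
        simp [mN, hx f hf]
    · rw [eN_succ _ _ _ _ hxy, setLIntegral_congr_fun (g := fun f => 1 + mN y n (s + 1) f)
        hD.measurableSet]
      swap
      · intro f hf
        simp [mN, hx f hf, hxy]
      rw [lintegral_add_left measurable_const, setLIntegral_one]
      set up : Set (ℕ → ℤ) := {g | g (s + 1) = x + 1} with hup
      set dn : Set (ℕ → ℤ) := {g | g (s + 1) = x - 1} with hdn
      have mup : MeasurableSet up := measurable_pi_apply (s + 1) (measurableSet_singleton _)
      have mdn : MeasurableSet dn := measurable_pi_apply (s + 1) (measurableSet_singleton _)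
      have h1 : μ (D ∩ up) = ENNReal.ofReal (env x) * μ D := by
        rw [hup, markov_step henv h hD hx]; simp [stepProb]
      have h2 : μ (D ∩ dn) = ENNReal.ofReal (1 - env x) * μ D := by
        have : x - 1 ≠ x + 1 := by omega
        rw [hdn, markov_step henv h hD hx]; simp [stepProb, this]
      have hae : (D ∩ dn : Set (ℕ → ℤ)) =ᵐ[μ] (D \ up : Set (ℕ → ℤ)) := by
        refine ae_eq_of_subset_of_measure_ge ?_ ?_ (hD.measurableSet.inter mdn).nullMeasurableSet
          (measure_ne_top _ _)
        · rintro g ⟨hg1, hg2⟩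
          refine ⟨hg1, fun hg3 => ?_⟩
          simp only [hup, hdn, Set.mem_ofPred_eq] at hg2 hg3
          omega
        · have h3 := measure_inter_add_sdiff (μ := μ) D mup
          have h4 : μ (D ∩ up) + μ (D ∩ dn) = μ D := by
            rw [h1, h2, ← add_mul, ← ENNReal.ofReal_add (henv x).1.le (by linarith [(henv x).2])]
            simp
          rw [← h3] at h4
          exact ((ENNReal.add_right_inj (measure_ne_top _ _)).1 h4).ge
      have hDet : ∀ z : ℤ, Det (D ∩ {g | g (s + 1) = z}) (s + 1) := by
        rintro z f g hfg ⟨hf1, hf2⟩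
        refine ⟨hD f g (fun k hk => hfg k (by omega)) hf1, ?_⟩
        have := hfg (s + 1) le_rfl
        simp only [Set.mem_ofPred_eq] at hf2 ⊢
        omega
      rw [← lintegral_inter_add_sdiff _ D mup, ← setLIntegral_congr hae,
        ih (hDet (x + 1)) (fun f hf => hf.2), ih (hDet (x - 1)) (fun f hf => hf.2), ← hup, ← hdn,
        h1, h2]
      ring

/-! ### Hitting times -/

lemma hit_ex (y : ℤ) (f : ℕ → ℤ) : ∃ n, f n = y ∨ ∀ m, f m ≠ y := by
  by_cases h : ∃ n, f n = y
  · exact ⟨h.choose, Or.inl h.choose_spec⟩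
  · push Not at h
    exact ⟨0, Or.inr h⟩

open Classical in
/-- First hitting time of `y` (zero if `y` is never hit). -/
def hitT (y : ℤ) (f : ℕ → ℤ) : ℕ := Nat.find (hit_ex y f)

lemma measurable_hitT (y : ℤ) : Measurable (hitT y) := by
  classical
  unfold hitT
  refine measurable_find _ fun k => ?_
  have h1 : ∀ m : ℕ, MeasurableSet {f : ℕ → ℤ | f m = y} := fun m =>
    measurableSet_eq_fun (measurable_pi_apply m) measurable_const
  refine (h1 k).union ?_
  have : {f : ℕ → ℤ | ∀ m, f m ≠ y} = ⋂ m, {f : ℕ → ℤ | f m = y}ᶜ := by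
    ext f; simp
  have hm : MeasurableSet {f : ℕ → ℤ | ∀ m, f m ≠ y} := by
    rw [this]; exact MeasurableSet.iInter fun m => (h1 m).compl
  exact hm

lemma hitT_spec {y : ℤ} {f : ℕ → ℤ} (h : ∃ n, f n = y) : f (hitT y f) = y := by
  classical
  obtain ⟨n, hn⟩ := h
  rcases Nat.find_spec (hit_ex y f) with h1 | h1
  · unfold hitT; convert h1
  · exact absurd hn (h1 n)

lemma hitT_min {y : ℤ} {f : ℕ → ℤ} {j : ℕ} (hj : j < hitT y f) : f j ≠ y := by
  classical
  have : j < Nat.find (hit_ex y f) := by unfold hitT at hj; convert hj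
  have := Nat.find_min (hit_ex y f) this
  tauto

lemma hitT_le {y : ℤ} {f : ℕ → ℤ} {j : ℕ} (hj : f j = y) : hitT y f ≤ j := by
  by_contra h
  push Not at h
  exact hitT_min h hj

lemma mN_eq_min (y : ℤ) (f : ℕ → ℤ) (n s t : ℕ) (hst : s ≤ t) (ht : f t = y)
    (hlt : ∀ j, j < t → f j ≠ y) : mN y n s f = min ((t - s : ℕ) : ℝ≥0∞) n := by
  induction n generalizing s with
  | zero => simp [mN]
  | succ n ih =>
    rcases hst.eq_or_lt with rfl | h
    · simp [mN, ht]
    · simp only [mN, if_neg (hlt s h)]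
      rw [ih (s + 1) h]
      have : t - s = (t - (s + 1)) + 1 := by omega
      rw [this]
      push_cast
      rw [min_add_add_right, add_comm]

/-- Nearest neighbour path from zero tending to `+∞`. -/
def Good (f : ℕ → ℤ) : Prop :=
  f 0 = 0 ∧ (∀ s, f (s + 1) = f s + 1 ∨ f (s + 1) = f s - 1) ∧ Tendsto f atTop atTop

lemma ivt {f : ℕ → ℤ} (hs : ∀ s, f (s + 1) = f s + 1 ∨ f (s + 1) = f s - 1) (x : ℤ) (n : ℕ)
    (h0 : f 0 ≤ x) (hn : x ≤ f n) : ∃ j ≤ n, f j = x := by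
  induction n with
  | zero => exact ⟨0, le_rfl, by omega⟩
  | succ n ih =>
    by_cases h : x ≤ f n
    · obtain ⟨j, hj, hjx⟩ := ih h
      exact ⟨j, by omega, hjx⟩
    · refine ⟨n + 1, le_rfl, ?_⟩
      have := hs n
      omega

lemma Good.hit {f : ℕ → ℤ} (h : Good f) {x : ℤ} (hx : 0 ≤ x) : ∃ n, f n = x := by
  obtain ⟨n, hn⟩ := (h.2.2.eventually_ge_atTop x).exists
  obtain ⟨j, -, hj⟩ := ivt h.2.1 x n (by rw [h.1]; exact hx) hn
  exact ⟨j, hj⟩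

lemma Good.hitT_mono {f : ℕ → ℤ} (h : Good f) {x y : ℤ} (hx : 0 ≤ x) (hxy : x ≤ y) :
    hitT x f ≤ hitT y f := by
  have hy := hitT_spec (h.hit (hx.trans hxy))
  obtain ⟨j, hj, hjx⟩ := ivt h.2.1 x (hitT y f) (by rw [h.1]; exact hx) (by rw [hy]; exact hxy)
  exact (hitT_le hjx).trans hj

lemma Good.le {f : ℕ → ℤ} (h : Good f) (n : ℕ) : f n ≤ n := by
  induction n with
  | zero => simp [h.1]
  | succ n ih => have := h.2.1 n; push_cast; omega

lemma Good.le_hitT {f : ℕ → ℤ} (h : Good f) {x : ℤ} (hx : 0 ≤ x) : x ≤ hitT x f := by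
  have := h.le (hitT x f)
  rwa [hitT_spec (h.hit hx)] at this

lemma Good.hitT_zero {f : ℕ → ℤ} (h : Good f) : hitT 0 f = 0 :=
  Nat.le_zero.1 (hitT_le h.1)

lemma Good.mN_eq {f : ℕ → ℤ} (h : Good f) {x y : ℤ} (hx : 0 ≤ x) (hxy : x ≤ y) (n : ℕ) :
    mN y n (hitT x f) f = min ((hitT y f - hitT x f : ℕ) : ℝ≥0∞) n :=
  mN_eq_min y f n _ _ (h.hitT_mono hx hxy) (hitT_spec (h.hit (hx.trans hxy)))
    (fun _ hj => hitT_min hj)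

lemma lintegral_hit {env : ℤ → ℝ} (henv : ∀ x, env x ∈ Set.Ioo (0 : ℝ) 1) {μ : Measure (ℕ → ℤ)}
    (h : IsQuenchedRW env 0 μ) (hg : ∀ᵐ f ∂μ, Good f) (x y : ℤ) (hx : 0 ≤ x) (hxy : x ≤ y)
    (n : ℕ) :
    ∫⁻ f, min ((hitT y f - hitT x f : ℕ) : ℝ≥0∞) n ∂μ =
      eN (fun x => ENNReal.ofReal (env x)) (fun x => ENNReal.ofReal (1 - env x)) y n x := by
  have := h.1
  set D : ℕ → Set (ℕ → ℤ) := fun s => {f | f s = x ∧ ∀ j < s, f j ≠ x} with hDdef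
  have hDet : ∀ s, Det (D s) s := by
    rintro s f g hfg ⟨h1, h2⟩
    refine ⟨by rw [← hfg s le_rfl]; exact h1, fun j hj => ?_⟩
    rw [← hfg j hj.le]
    exact h2 j hj
  have hdisj : Pairwise (Function.onFun Disjoint D) := by
    intro s t hst
    rw [Function.onFun, Set.disjoint_left]
    rintro f ⟨h1, h2⟩ ⟨h3, h4⟩
    rcases lt_or_gt_of_ne hst with hlt | hlt
    · exact h4 s hlt h1
    · exact h2 t hlt h3
  have hT : ∀ s, ∀ f ∈ D s, hitT x f = s := by
    rintro s f ⟨h1, h2⟩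
    apply le_antisymm (hitT_le h1)
    by_contra hc
    push Not at hc
    exact h2 _ hc (hitT_spec ⟨s, h1⟩)
  have hU : (⋃ s, D s : Set (ℕ → ℤ)) =ᵐ[μ] Set.univ := by
    rw [eventuallyEq_univ]
    filter_upwards [hg] with f hf
    rw [Set.mem_iUnion]
    exact ⟨hitT x f, hitT_spec (hf.hit hx), fun j hj => hitT_min hj⟩
  have e1 : ∫⁻ f, min ((hitT y f - hitT x f : ℕ) : ℝ≥0∞) n ∂μ
      = ∫⁻ f, mN y n (hitT x f) f ∂μ := by
    refine lintegral_congr_ae ?_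
    filter_upwards [hg] with f hf
    rw [hf.mN_eq hx hxy]
  rw [e1, ← setLIntegral_univ, ← setLIntegral_congr hU,
    lintegral_iUnion (fun s => (hDet s).measurableSet) hdisj]
  have e2 : ∀ s, ∫⁻ f in D s, mN y n (hitT x f) f ∂μ = μ (D s) *
      eN (fun x => ENNReal.ofReal (env x)) (fun x => ENNReal.ofReal (1 - env x)) y n x := by
    intro s
    rw [← lintegral_mN henv h y n (hDet s) (fun f hf => hf.1)]
    refine setLIntegral_congr_fun (hDet s).measurableSet fun f hf => ?_
    simp only [hT s f hf]
  rw [tsum_congr e2, ENNReal.tsum_mul_right,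
    ← measure_iUnion hdisj (fun s => (hDet s).measurableSet), measure_congr hU, measure_univ,
    one_mul]

/-! ### The environment on sequence space -/

/-- Sequences of pairs. -/
abbrev Sq := ℤ → ℝ × ℕ

/-- Gaps (made positive). -/
def gap (f : Sq) (k : ℤ) : ℕ := max (f k).2 1

/-- Marked sites. -/
def site (f : Sq) (k : ℤ) : ℤ :=
  ∑ i ∈ Finset.Ioc 0 k, (gap f i : ℤ) - ∑ i ∈ Finset.Ioc k 0, (gap f i : ℤ)

lemma site_zero (f : Sq) : site f 0 = 0 := by simp [site]

lemma site_rec (f : Sq) (k : ℤ) : site f k - site f (k - 1) = gap f k := by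
  unfold site
  rcases le_or_gt k 0 with h | h
  · have e1 : Finset.Ioc (0 : ℤ) k = ∅ := Finset.Ioc_eq_empty (by omega)
    have e2 : Finset.Ioc (0 : ℤ) (k - 1) = ∅ := Finset.Ioc_eq_empty (by omega)
    have e3 : Finset.Ioc (k - 1) 0 = insert k (Finset.Ioc k 0) := by
      ext i; simp; omega
    rw [e1, e2, e3, Finset.sum_insert (by simp)]
    simp
  · have e1 : Finset.Ioc k 0 = ∅ := Finset.Ioc_eq_empty (by omega)
    have e2 : Finset.Ioc (k - 1) 0 = ∅ := Finset.Ioc_eq_empty (by omega)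
    have e3 : Finset.Ioc (0 : ℤ) k = insert k (Finset.Ioc 0 (k - 1)) := by
      ext i; simp; omega
    rw [e1, e2, e3, Finset.sum_insert (by simp)]
    simp

lemma rec_unique (a b g : ℤ → ℤ) (h0 : a 0 = b 0) (ha : ∀ k, a k - a (k - 1) = g k)
    (hb : ∀ k, b k - b (k - 1) = g k) : a = b := by
  ext k
  induction k using Int.induction_on with
  | zero => exact h0
  | succ i ih =>
    have h1 := ha (i + 1)
    have h2 := hb (i + 1)
    rw [add_sub_cancel_right] at h1 h2
    omega
  | pred i ih =>
    have h1 := ha (-i)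
    have h2 := hb (-i)
    omega

lemma site_strictMono (f : Sq) : StrictMono (site f) := by
  refine strictMono_int_of_lt_succ fun k => ?_
  have := site_rec f (k + 1)
  rw [add_sub_cancel_right] at this
  have h : 1 ≤ gap f (k + 1) := le_max_right _ _
  omega

lemma measurable_gap (k : ℤ) : Measurable fun f : Sq => gap f k :=
  (measurable_snd.comp (measurable_pi_apply k)).max measurable_const

lemma measurable_site (k : ℤ) : Measurable fun f : Sq => site f k := by
  unfold site
  have : ∀ i : ℤ, Measurable fun f : Sq => (gap f i : ℤ) := fun i =>
    (measurable_from_top (f := fun n : ℕ => (n : ℤ))).comp (measurable_gap i)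
  exact (Finset.measurable_sum _ fun i _ => this i).sub (Finset.measurable_sum _ fun i _ => this i)

/-- The sparse environment as function of the sequence. -/
def envS (f : Sq) : ℤ → ℝ := sparseEnv (fun k => (f k).1) (site f)

lemma sparseEnv_mark (lam : ℤ → ℝ) {a : ℤ → ℤ} (ha : Function.Injective a) (k : ℤ) :
    sparseEnv lam a (a k) = lam k := by
  have h : ∃ j, a j = a k := ⟨k, rfl⟩
  unfold sparseEnv
  rw [dif_pos h, ha h.choose_spec]

lemma sparseEnv_unmark (lam : ℤ → ℝ) {a : ℤ → ℤ} {n : ℤ} (h : ∀ k, a k ≠ n) :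
    sparseEnv lam a n = 1 / 2 := by
  unfold sparseEnv
  rw [dif_neg (by push Not; exact h)]

lemma sparseEnv_shift (lam : ℤ → ℝ) {a : ℤ → ℤ} (ha : Function.Injective a) (k c n : ℤ) :
    sparseEnv (fun j => lam (j + k)) (fun j => a (j + k) + c) n = sparseEnv lam a (n - c) := by
  have hi : Function.Injective (fun j => a (j + k) + c) := fun i j hij => by
    have := ha (add_right_cancel hij)
    omega
  by_cases h : ∃ j, a j = n - c
  · obtain ⟨j, hj⟩ := h
    have e : n = (fun j => a (j + k) + c) (j - k) := by simp [hj]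
    rw [← hj, sparseEnv_mark lam ha]
    rw [e, sparseEnv_mark _ hi]
    simp
  · push Not at h
    rw [sparseEnv_unmark lam h, sparseEnv_unmark]
    intro j hj
    exact h (j + k) (by omega)

lemma measurable_envS (n : ℤ) : Measurable fun f : Sq => envS f n := by
  have hA : ∀ k, MeasurableSet {f : Sq | site f k = n} := fun k =>
    measurable_site k (measurableSet_singleton n)
  intro s hs
  have : (fun f : Sq => envS f n) ⁻¹' s =
      (⋃ k : ℤ, {f : Sq | site f k = n} ∩ (fun f : Sq => (f k).1) ⁻¹' s) ∪
      ((⋂ k : ℤ, {f : Sq | site f k = n}ᶜ) ∩ (fun _ : Sq => (1 / 2 : ℝ)) ⁻¹' s) := by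
    ext f
    by_cases h : ∃ k, site f k = n
    · obtain ⟨k, hk⟩ := h
      have e : envS f n = (f k).1 := by
        rw [envS, ← hk, sparseEnv_mark _ (site_strictMono f).injective]
      simp only [Set.mem_preimage, e, Set.mem_union, Set.mem_iUnion, Set.mem_inter_iff,
        Set.mem_ofPred_eq, Set.mem_iInter, Set.mem_compl_iff]
      constructor
      · intro hs; exact Or.inl ⟨k, hk, hs⟩
      · rintro (⟨j, hj, hjs⟩ | ⟨h1, -⟩)
        · rwa [(site_strictMono f).injective (hk.trans hj.symm)]
        · exact absurd hk (h1 k)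
    · push Not at h
      have e : envS f n = 1 / 2 := sparseEnv_unmark _ h
      simp only [Set.mem_preimage, e, Set.mem_union, Set.mem_iUnion, Set.mem_inter_iff,
        Set.mem_ofPred_eq, Set.mem_iInter, Set.mem_compl_iff]
      constructor
      · intro hs; exact Or.inr ⟨h, hs⟩
      · rintro (⟨j, hj, hjs⟩ | ⟨h1, h2⟩)
        · exact absurd hj (h j)
        · exact h2
  rw [this]
  refine MeasurableSet.union (MeasurableSet.iUnion fun k => (hA k).inter ?_)
    ((MeasurableSet.iInter fun k => (hA k).compl).inter (measurable_const hs))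
  exact (measurable_fst.comp (measurable_pi_apply k)) hs

/-- shift by `k` -/
def shf (k : ℤ) (f : Sq) : Sq := fun n => f (n + k)

lemma site_shf (k : ℤ) (f : Sq) (j : ℤ) : site (shf k f) j = site f (j + k) - site f k := by
  refine congrFun (rec_unique (site (shf k f)) (fun j => site f (j + k) - site f k)
    (fun j => gap f (j + k)) ?_ ?_ ?_) j
  · simp [site_zero]
  · intro i; rw [site_rec]; rfl
  · intro i
    have := site_rec f (i + k)
    have e : i - 1 + k = i + k - 1 := by ring
    simp only [e]
    omega

lemma envS_shf (k : ℤ) (f : Sq) (n : ℤ) : envS (shf k f) n = envS f (n + site f k) := by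
  have := sparseEnv_shift (fun k => (f k).1) (site_strictMono f).injective k (-site f k) n
  rw [sub_neg_eq_add] at this
  rw [envS, envS, ← this]
  congr 1
  ext j
  rw [site_shf]
  ring

lemma envS_mem {f : Sq} (h : ∀ k, (f k).1 ∈ Set.Ioo (0 : ℝ) 1) (n : ℤ) :
    envS f n ∈ Set.Ioo (0 : ℝ) 1 := by
  by_cases hn : ∃ k, site f k = n
  · obtain ⟨k, rfl⟩ := hn
    rw [envS, sparseEnv_mark _ (site_strictMono f).injective]
    exact h k
  · push Not at hn
    rw [envS, sparseEnv_unmark _ hn]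
    norm_num

/-- Truncated expected time to cross from `site 0` to `site 1`. -/
def crossN (N : ℕ) (f : Sq) : ℝ≥0∞ :=
  eN (fun x => ENNReal.ofReal (envS f x)) (fun x => ENNReal.ofReal (1 - envS f x)) (site f 1) N 0

lemma crossN_shf (N : ℕ) (f : Sq) (k : ℤ) :
    crossN N (shf k f) = eN (fun x => ENNReal.ofReal (envS f x))
      (fun x => ENNReal.ofReal (1 - envS f x)) (site f (k + 1)) N (site f k) := by
  unfold crossN
  have := eN_shift (fun x => ENNReal.ofReal (envS f x)) (fun x => ENNReal.ofReal (1 - envS f x))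
    (site f (1 + k) - site f k) (site f k) N 0
  rw [site_shf]
  simp only [envS_shf]
  rw [this, sub_add_cancel, zero_add, add_comm 1 k]

lemma measurable_eN {α : Type*} [MeasurableSpace α] (p q : α → ℤ → ℝ≥0∞)
    (hp : ∀ x, Measurable fun a => p a x) (hq : ∀ x, Measurable fun a => q a x) (y : ℤ) (n : ℕ)
    (x : ℤ) : Measurable fun a => eN (p a) (q a) y n x := by
  induction n generalizing x with
  | zero => exact measurable_const
  | succ n ih =>
    by_cases h : x = y
    · subst h; simp only [eN_self]; exact measurable_const
    · simp only [eN_succ _ _ _ _ h]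
      exact (measurable_const.add ((hp x).mul (ih _))).add ((hq x).mul (ih _))

lemma measurable_crossN (N : ℕ) : Measurable (crossN N) := by
  have h0 : ∀ y : ℤ, Measurable fun f : Sq => eN (fun x => ENNReal.ofReal (envS f x))
      (fun x => ENNReal.ofReal (1 - envS f x)) y N 0 := fun y =>
    measurable_eN (fun f : Sq => fun x => ENNReal.ofReal (envS f x))
      (fun f : Sq => fun x => ENNReal.ofReal (1 - envS f x))
      (fun x => (measurable_envS x).ennreal_ofReal)
      (fun x => (measurable_const.sub (measurable_envS x)).ennreal_ofReal) y N 0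
  have h1 : crossN N = fun f => ∑' y : ℤ, Set.indicator {f : Sq | site f 1 = y}
      (fun f => eN (fun x => ENNReal.ofReal (envS f x))
        (fun x => ENNReal.ofReal (1 - envS f x)) y N 0) f := by
    ext f
    rw [tsum_eq_single (site f 1)]
    · rw [Set.indicator_of_mem (by simp)]
      rfl
    · intro y hy
      rw [Set.indicator_of_notMem]
      exact fun h => hy h.symm
  rw [h1]
  exact Measurable.tsum fun y => (h0 y).indicator
    (measurableSet_eq_fun (measurable_site 1) measurable_const)

lemma measurable_Sx (x : ℤ) : Measurable fun f : Sq => Sx (rhoOf (envS f)) x := by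
  have hr : ∀ n, Measurable fun f : Sq => ENNReal.ofReal (rhoOf (envS f) n) := fun n =>
    ((measurable_const.sub (measurable_envS n)).div (measurable_envS n)).ennreal_ofReal
  unfold Sx Stilde
  refine ((Measurable.tsum fun i => ?_).add measurable_const).add (hr _)
  exact (measurable_const.add (hr _)).mul (Finset.measurable_prod _ fun j _ => hr _)

lemma Sx_shf (k : ℤ) (f : Sq) (x : ℤ) :
    Sx (rhoOf (envS (shf k f))) x = Sx (rhoOf (envS f)) (x + site f k) := by
  unfold Sx rhoOf
  simp only [envS_shf, add_assoc]

/-! ### Stationarity -/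

lemma measurable_shf (k : ℤ) : Measurable (shf k) :=
  measurable_pi_lambda _ fun _ => measurable_pi_apply _

lemma lintegral_shf {L : Measure Sq} (h1 : MeasurePreserving (shf 1) L L) (k : ℕ) {G : Sq → ℝ≥0∞}
    (hG : Measurable G) : ∫⁻ f, G (shf k f) ∂L = ∫⁻ f, G f ∂L := by
  induction k with
  | zero =>
    refine lintegral_congr fun f => ?_
    congr 1
    ext1 n
    simp [shf]
  | succ k ih =>
    have hc := h1.lintegral_comp (hG.comp (measurable_shf k))
    simp only [Function.comp] at hc
    rw [← ih, ← hc]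
    refine lintegral_congr fun f => ?_
    congr 1
    ext1 n
    simp only [shf]
    congr 1
    push_cast
    ring

lemma measurable_sum_gap (H : ℤ → Sq → ℝ≥0∞) (hH : ∀ i, Measurable (H i)) :
    Measurable fun f : Sq => ∑ i ∈ Finset.range (gap f 0), H i f := by
  have : (fun f : Sq => ∑ i ∈ Finset.range (gap f 0), H i f)
      = fun f => ∑' i : ℕ, Set.indicator {f : Sq | i < gap f 0} (fun f => H i f) f := by
    ext f
    rw [tsum_eq_sum (s := Finset.range (gap f 0))]
    · refine Finset.sum_congr rfl fun i hi => ?_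
      rw [Set.indicator_of_mem]
      exact Finset.mem_range.1 hi
    · intro i hi
      rw [Set.indicator_of_notMem]
      intro h
      exact hi (Finset.mem_range.2 h)
  rw [this]
  exact Measurable.tsum fun i => (hH i).indicator
    (measurableSet_lt measurable_const (measurable_gap 0))

lemma site_one (f : Sq) : site f 1 = gap f 1 := by
  have := site_rec f 1
  rw [sub_self, site_zero] at this
  omega

lemma cross_eq_dual {L : Measure Sq} (h1 : MeasurePreserving (shf 1) L L)
    (h01 : ∀ᵐ f ∂L, ∀ k, (f k).1 ∈ Set.Ioo (0 : ℝ) 1) :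
    ∫⁻ f, (⨆ N, crossN N f) ∂L
      = ∫⁻ f, ∑ i ∈ Finset.range (gap f 0), Sx (rhoOf (envS f)) (-(i : ℤ)) ∂L := by
  have e1 : ∫⁻ f, (⨆ N, crossN N f) ∂L = ∫⁻ f, ((∑ i ∈ Finset.range (gap f 1 - 1),
      Sx (rhoOf (envS f)) (gap f 1 - (i + 1 : ℕ))) + Sx (rhoOf (envS f)) 0) ∂L := by
    refine lintegral_congr_ae ?_
    filter_upwards [h01] with f hf
    have := eI_eq_sum (envS f) (envS_mem hf) (gap f 1) (gap f 1)
    rw [sub_self] at this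
    have e : (⨆ N, crossN N f) = eI (fun x => ENNReal.ofReal (envS f x))
      (fun x => ENNReal.ofReal (1 - envS f x)) (gap f 1) 0 := by
      unfold crossN eI
      rw [site_one]
    rw [e, this]
    obtain ⟨g, hg⟩ : ∃ g, gap f 1 = g + 1 := ⟨gap f 1 - 1, by
      have : 1 ≤ gap f 1 := le_max_right _ _
      omega⟩
    rw [hg, Finset.sum_range_succ]
    simp
  have e2 : ∫⁻ f, ∑ i ∈ Finset.range (gap f 0), Sx (rhoOf (envS f)) (-(i : ℤ)) ∂L
      = ∫⁻ f, ((∑ i ∈ Finset.range (gap f 1 - 1),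
      Sx (rhoOf (envS f)) (gap f 1 - (i + 1 : ℕ))) + Sx (rhoOf (envS (shf 1 f))) 0) ∂L := by
    rw [← h1.lintegral_comp (measurable_sum_gap (fun i f => Sx (rhoOf (envS f)) (-i))
      fun i => measurable_Sx _)]
    refine lintegral_congr fun f => ?_
    have eg : gap (shf 1 f) 0 = gap f 1 := by simp [gap, shf]
    rw [eg]
    simp only [Sx_shf, site_one]
    obtain ⟨g, hg⟩ : ∃ g, gap f 1 = g + 1 := ⟨gap f 1 - 1, by
      have : 1 ≤ gap f 1 := le_max_right _ _
      omega⟩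
    rw [hg, Finset.sum_range_succ']
    simp only [add_tsub_cancel_right, Nat.cast_zero, neg_zero]
    refine congrArg₂ _ (Finset.sum_congr rfl fun i _ => ?_) rfl
    rw [neg_add_eq_sub]
  have hm : Measurable fun f : Sq => Sx (rhoOf (envS (shf 1 f))) 0 :=
    (measurable_Sx 0).comp (measurable_shf 1)
  rw [e1, e2, lintegral_add_right _ (measurable_Sx 0), lintegral_add_right _ hm,
    h1.lintegral_comp (measurable_Sx 0)]

/-! ### The uniform variable -/

lemma lintegral_floor (g : ℕ) (hg : 1 ≤ g) (h : ℤ → ℝ≥0∞) :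
    ∫⁻ u in Set.Icc (0 : ℝ) 1, (g : ℝ≥0∞) * h ⌊u * (g : ℝ)⌋
      = ∑ i ∈ Finset.range g, h i := by
  have hg0 : (0 : ℝ) < g := by exact_mod_cast hg
  have hm : Measurable fun u : ℝ => h ⌊u * (g : ℝ)⌋ :=
    (measurable_from_top (f := h)).comp (Int.measurable_floor.comp (measurable_id.mul_const _))
  rw [lintegral_const_mul _ hm, ← setLIntegral_congr (Ico_ae_eq_Icc (μ := volume))]
  have e : ∀ u ∈ Set.Ico (0 : ℝ) 1, h ⌊u * (g : ℝ)⌋ = ∑ i ∈ Finset.range g,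
      Set.indicator (Set.Ico ((i : ℝ) / g) ((i + 1 : ℝ) / g)) (fun _ => h i) u := by
    intro u hu
    have hfl : 0 ≤ ⌊u * (g : ℝ)⌋ := Int.floor_nonneg.2 (mul_nonneg hu.1 hg0.le)
    obtain ⟨m, hmm⟩ := Int.eq_ofNat_of_zero_le hfl
    have hmem : ∀ i : ℕ, u ∈ Set.Ico ((i : ℝ) / g) ((i + 1 : ℝ) / g) ↔ i = m := by
      intro i
      rw [Set.mem_Ico, div_le_iff₀ hg0, lt_div_iff₀ hg0]
      have := Int.floor_eq_iff (a := u * (g : ℝ)) (z := (i : ℤ))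
      push_cast at this
      rw [← this, hmm]
      constructor
      · intro h; exact_mod_cast h.symm
      · intro h; rw [h]
    rw [Finset.sum_eq_single m]
    · rw [Set.indicator_of_mem ((hmem m).2 rfl), hmm]
    · intro i _ hi
      rw [Set.indicator_of_notMem]
      rw [hmem]; exact hi
    · intro hmg
      exfalso
      apply hmg
      rw [Finset.mem_range]
      have h1 : ⌊u * (g : ℝ)⌋ < (g : ℤ) := by
        rw [Int.floor_lt]
        push_cast
        nlinarith [hu.2]
      rw [hmm] at h1
      exact_mod_cast h1
  rw [setLIntegral_congr_fun measurableSet_Ico e, lintegral_finsetSum, Finset.mul_sum]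
  · refine Finset.sum_congr rfl fun i hi => ?_
    have hig : (i : ℝ) + 1 ≤ g := by exact_mod_cast Finset.mem_range.1 hi
    have hs : Set.Ico ((i : ℝ) / g) ((i + 1 : ℝ) / g) ⊆ Set.Ico 0 1 :=
      Set.Ico_subset_Ico (by positivity) ((div_le_one hg0).2 hig)
    rw [lintegral_indicator_const measurableSet_Ico, Measure.restrict_apply measurableSet_Ico,
      Set.inter_eq_left.2 hs, Real.volume_Ico, ← sub_div, add_sub_cancel_left, mul_left_comm,
      ENNReal.ofReal_div_of_pos hg0, ENNReal.ofReal_one, ENNReal.ofReal_natCast,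
      ENNReal.mul_div_cancel (by simp; omega) (ENNReal.natCast_ne_top g), mul_one]
  · intro i _
    exact measurable_const.indicator measurableSet_Ico

lemma lintegral_dual {Ω : Type*} [MeasurableSpace Ω] (P : Measure Ω) [IsProbabilityMeasure P]
    (U : Ω → ℝ) (hU : Measurable U) (Φ : Ω → Sq) (hΦ : Measurable Φ)
    (hU_law : P.map U = volume.restrict (Set.Icc (0 : ℝ) 1)) (hi : IndepFun U Φ P)
    (H : ℤ → Sq → ℝ≥0∞) (hH : ∀ i, Measurable (H i)) :
    ∫⁻ ω, (gap (Φ ω) 0 : ℝ≥0∞) * H ⌊U ω * (gap (Φ ω) 0 : ℝ)⌋ (Φ ω) ∂P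
      = ∫⁻ f, ∑ i ∈ Finset.range (gap f 0), H i f ∂(P.map Φ) := by
  have : IsProbabilityMeasure (P.map Φ) := Measure.isProbabilityMeasure_map hΦ.aemeasurable
  have hmap := (indepFun_iff_map_prod_eq_prod_map_map hU.aemeasurable hΦ.aemeasurable).1 hi
  rw [hU_law] at hmap
  have hgm : Measurable fun z : ℝ × Sq => gap z.2 0 := (measurable_gap 0).comp measurable_snd
  have hHm : Measurable fun z : ℤ × Sq => H z.1 z.2 :=
    measurable_from_prod_countable_right fun i => hH i
  have hgr : Measurable fun z : ℝ × Sq => (gap z.2 0 : ℝ) :=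
    (measurable_from_top (f := fun n : ℕ => (n : ℝ))).comp hgm
  have hge : Measurable fun z : ℝ × Sq => (gap z.2 0 : ℝ≥0∞) :=
    (measurable_from_top (f := fun n : ℕ => (n : ℝ≥0∞))).comp hgm
  have hF : Measurable fun z : ℝ × Sq =>
      (gap z.2 0 : ℝ≥0∞) * H ⌊z.1 * (gap z.2 0 : ℝ)⌋ z.2 := by
    refine hge.mul ?_
    exact hHm.comp ((Int.measurable_floor.comp (measurable_fst.mul hgr)).prodMk measurable_snd)
  have e := lintegral_map (μ := P) hF (hU.prodMk hΦ)
  simp only at e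
  rw [← e, hmap, lintegral_prod_symm' _ hF]
  refine lintegral_congr fun f => ?_
  exact lintegral_floor (gap f 0) (le_max_right _ _) (fun i => H i f)

/-! ### Pathwise limits -/

lemma path_ratio {f : ℕ → ℤ} (h : Good f) {v : ℝ}
    (hv : Tendsto (fun n : ℕ => (f n : ℝ) / (n : ℝ)) atTop (𝓝 v)) (b : ℕ → ℤ)
    (hb : ∀ n : ℕ, (n : ℤ) ≤ b n) :
    Tendsto (fun n => (b n : ℝ) / (hitT (b n) f : ℝ)) atTop (𝓝 v) := by
  have h0 : ∀ n, 0 ≤ b n := fun n => le_trans (by positivity) (hb n)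
  have ht : Tendsto (fun n => hitT (b n) f) atTop atTop := by
    refine tendsto_atTop_mono (fun n => ?_) tendsto_id
    have h1 := h.le_hitT (h0 n)
    have h2 := hb n
    simp only [id]
    omega
  refine (hv.comp ht).congr fun n => ?_
  simp only [Function.comp]
  rw [hitT_spec (h.hit (h0 n))]

lemma le_limit {x y : ℝ≥0∞} (hy : y ≠ ⊤) (c₀ : ℝ)
    (h : ∀ c : ℝ, c₀ < c → x ≤ ENNReal.ofReal c * y) : x ≤ ENNReal.ofReal c₀ * y := by
  have h1 : Tendsto (fun c : ℝ => ENNReal.ofReal c * y) (𝓝[>] c₀) (𝓝 (ENNReal.ofReal c₀ * y)) :=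
    ENNReal.Tendsto.mul_const
      ((ENNReal.continuous_ofReal.tendsto c₀).mono_left nhdsWithin_le_nhds) (Or.inr hy)
  exact ge_of_tendsto h1 (by filter_upwards [self_mem_nhdsWithin] with c hc using h c hc)

lemma lintegral_eq_iSup_min {α : Type*} [MeasurableSpace α] (μ : Measure α) (A : α → ℝ≥0∞)
    (hA : Measurable A) (hAt : ∀ x, A x ≠ ⊤) :
    ∫⁻ x, A x ∂μ = ⨆ N : ℕ, ∫⁻ x, min (A x) N ∂μ := by
  have hsup : ∀ x, A x = ⨆ N : ℕ, min (A x) N := by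
    intro x
    apply le_antisymm
    · obtain ⟨N, hN⟩ := ENNReal.exists_nat_gt (hAt x)
      exact le_iSup_of_le N (le_min le_rfl hN.le)
    · exact iSup_le fun N => min_le_left _ _
  rw [lintegral_congr hsup, lintegral_iSup]
  · exact fun N => hA.min measurable_const
  · intro i j hij x
    exact min_le_min_left _ (by exact_mod_cast hij)

/-- Proposition `compare-speed`: for a walk transient to the right with
`E_P(d_0) < ∞`, the speed equals `1 / E_Q(S̃)` where `Q` is the dual (size-biased) measure
and `S̃` is computed in the dual environment. -/
theorem statement3
    {Ω : Type*} [MeasurableSpace Ω] (P : Measure Ω) [IsProbabilityMeasure P]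
    (lam : ℤ → Ω → ℝ) (d : ℤ → Ω → ℕ) (a : ℤ → Ω → ℤ)
    (hlam_meas : ∀ k, Measurable (lam k)) (hd_meas : ∀ k, Measurable (d k))
    (hlam01 : ∀ k, ∀ᵐ ω ∂P, lam k ω ∈ Set.Ioo (0 : ℝ) 1)
    (hd_pos : ∀ k ω, 1 ≤ d k ω)
    (ha0 : ∀ ω, a 0 ω = 0)
    (ha_rec : ∀ ω, ∀ k : ℤ, a k ω - a (k - 1) ω = d k ω)
    (h_erg : Ergodic (fun f : ℤ → ℝ × ℕ => fun n => f (n + 1))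
      (P.map fun ω => fun n : ℤ => (lam n ω, d n ω)))
    (hexists :
      (∫⁻ ω, ENNReal.ofReal (Real.log ((1 - lam 0 ω) / lam 0 ω)) ∂P ≠ ⊤) ∨
      (∫⁻ ω, ENNReal.ofReal (-Real.log ((1 - lam 0 ω) / lam 0 ω)) ∂P ≠ ⊤))
    (hlogd : ∫⁻ ω, ENNReal.ofReal (Real.log (d 0 ω)) ∂P ≠ ⊤)
    (h_indep : IndepFun (fun ω => fun k : ℤ => d k ω) (fun ω => fun k : ℤ => lam k ω) P)
    -- `E_P(d_0) < ∞`
    (hd_int : ∫⁻ ω, (d 0 ω : ℝ≥0∞) ∂P ≠ ⊤)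
    -- the auxiliary uniform random variable used to build the dual environment
    (U : Ω → ℝ) (hU_meas : Measurable U)
    (hU_law : P.map U = volume.restrict (Set.Icc (0 : ℝ) 1))
    (hU_indep : IndepFun U (fun ω => fun k : ℤ => (lam k ω, d k ω)) P)
    -- quenched law and annealed law
    (K : Kernel Ω (ℕ → ℤ)) [IsMarkovKernel K]
    (hK : ∀ ω, IsQuenchedRW (sparseEnv (fun k => lam k ω) (fun k => a k ω)) 0 (K ω))
    -- transience to the right
    (h_trans : ∀ᵐ p ∂(P ⊗ₘ K), Tendsto (fun n => p.2 n) atTop atTop)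
    -- `v_P ∈ (0,1)` is the ℙ-a.s. asymptotic speed
    (v : ℝ) (hv01 : v ∈ Set.Ioo (0 : ℝ) 1)
    (hv : ∀ᵐ p ∂(P ⊗ₘ K), Tendsto (fun n : ℕ => (p.2 n : ℝ) / (n : ℝ)) atTop (𝓝 v)) :
    ENNReal.ofReal v =
      (∫⁻ ω, Stilde (rhoOf (sparseEnv (fun k => lam k ω)
          (fun k => a k ω + ⌊U ω * (d 0 ω : ℝ)⌋)))
        ∂(P.withDensity (fun ω => (d 0 ω : ℝ≥0∞) / ∫⁻ x, (d 0 x : ℝ≥0∞) ∂P)))⁻¹ := by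
  set Φ : Ω → Sq := fun ω => fun n : ℤ => (lam n ω, d n ω) with hΦdef
  have hΦ : Measurable Φ := measurable_pi_lambda _ fun k => (hlam_meas k).prodMk (hd_meas k)
  set L : Measure Sq := P.map Φ with hL
  have h1 : MeasurePreserving (shf 1) L L := h_erg.toMeasurePreserving
  have hgap : ∀ ω k, gap (Φ ω) k = d k ω := fun ω k => max_eq_left (hd_pos k ω)
  have hsite : ∀ ω, site (Φ ω) = fun k => a k ω := by
    intro ω
    refine rec_unique _ _ (fun k => (d k ω : ℤ)) ?_ ?_ (ha_rec ω)
    · rw [site_zero, ha0]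
    · intro k; rw [site_rec, hgap]
  have hsite' : ∀ ω k, site (Φ ω) k = a k ω := fun ω k => congrFun (hsite ω) k
  have henvS : ∀ ω, sparseEnv (fun k => lam k ω) (fun k => a k ω) = envS (Φ ω) := by
    intro ω
    rw [envS, hsite]
  have h01 : ∀ᵐ ω ∂P, ∀ k, (Φ ω k).1 ∈ Set.Ioo (0 : ℝ) 1 := ae_all_iff.2 hlam01
  have h01L : ∀ᵐ f ∂L, ∀ k, (f k).1 ∈ Set.Ioo (0 : ℝ) 1 := by
    refine ae_all_iff.2 fun k => ?_
    rw [hL, ae_map_iff hΦ.aemeasurable]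
    · exact hlam01 k
    · exact (measurable_fst.comp (measurable_pi_apply k)) measurableSet_Ioo
  have hinv : ∀ (k : ℕ) (G : Sq → ℝ≥0∞), Measurable G →
      ∫⁻ ω, G (shf k (Φ ω)) ∂P = ∫⁻ ω, G (Φ ω) ∂P := by
    intro k G hG
    have hc : Measurable fun f : Sq => G (shf k f) := hG.comp (measurable_shf k)
    rw [← lintegral_map hG hΦ, ← lintegral_shf h1 k hG, lintegral_map hc hΦ]
  simp only [henvS] at hK
  -- sites
  have ha_nn : ∀ ω (k : ℕ), 0 ≤ a k ω := by
    intro ω k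
    rw [← hsite', ← site_zero (Φ ω)]
    exact (site_strictMono _).monotone (by positivity)
  have ha_succ : ∀ ω (k : ℕ), a ((k + 1 : ℕ) : ℤ) ω = a k ω + d (k + 1) ω := by
    intro ω k
    have := ha_rec ω ((k + 1 : ℕ) : ℤ)
    push_cast at this ⊢
    rw [add_sub_cancel_right] at this
    omega
  have ha_mono : ∀ ω (k : ℕ), a k ω ≤ a ((k + 1 : ℕ) : ℤ) ω := by
    intro ω k; rw [ha_succ]; omega
  have ha_ge : ∀ ω (k : ℕ), (k : ℤ) ≤ a k ω := by
    intro ω k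
    induction k with
    | zero => simp [ha0]
    | succ k ih =>
      have := hd_pos (k + 1) ω
      rw [ha_succ]; push_cast; omega
  have ha_meas : ∀ k, Measurable (a k) := by
    intro k
    have : a k = fun ω => site (Φ ω) k := by ext ω; rw [hsite']
    rw [this]
    exact (measurable_site k).comp hΦ
  -- good paths
  have hgood_q : ∀ᵐ ω ∂P, ∀ᵐ f ∂(K ω), Good f := by
    filter_upwards [h01, Measure.ae_ae_of_ae_compProd h_trans] with ω hω hω2
    filter_upwards [hω2, start_ae (hK ω), step_ae (envS_mem hω) (hK ω)] with f hf1 hf2 hf3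
    exact ⟨hf2, hf3, hf1⟩
  have hgood : ∀ᵐ p ∂(P ⊗ₘ K), Good p.2 := by
    have hm : MeasurableSet {p : Ω × (ℕ → ℤ) | p.2 0 = 0 ∧
        ∀ s, p.2 (s + 1) = p.2 s + 1 ∨ p.2 (s + 1) = p.2 s - 1} := by
      have hc : ∀ s, Measurable fun p : Ω × (ℕ → ℤ) => p.2 s := fun s =>
        (measurable_pi_apply s).comp measurable_snd
      refine MeasurableSet.inter (measurableSet_eq_fun (hc 0) measurable_const) ?_
      have : {p : Ω × (ℕ → ℤ) | ∀ s, p.2 (s + 1) = p.2 s + 1 ∨ p.2 (s + 1) = p.2 s - 1}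
        = ⋂ s, ({p : Ω × (ℕ → ℤ) | p.2 (s + 1) = p.2 s + 1} ∪
          {p : Ω × (ℕ → ℤ) | p.2 (s + 1) = p.2 s - 1}) := by
        ext p; simp
      have hm2 : MeasurableSet
          {p : Ω × (ℕ → ℤ) | ∀ s, p.2 (s + 1) = p.2 s + 1 ∨ p.2 (s + 1) = p.2 s - 1} := by
        rw [this]
        refine MeasurableSet.iInter fun s => MeasurableSet.union ?_ ?_
        · exact measurableSet_eq_fun (hc _) ((hc s).add_const 1)
        · exact measurableSet_eq_fun (hc _) ((hc s).sub_const 1)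
      exact hm2
    have h2 := (Measure.ae_compProd_iff (μ := P) (κ := K) hm).2 (by
      filter_upwards [hgood_q] with ω hω
      filter_upwards [hω] with f hf using ⟨hf.1, hf.2.1⟩)
    filter_upwards [h2, h_trans] with p hp1 hp2 using ⟨hp1.1, hp1.2, hp2⟩
  -- the two sequences
  set A : ℕ → Ω × (ℕ → ℤ) → ℝ≥0∞ := fun k p =>
    ((hitT (a ((k + 1 : ℕ) : ℤ) p.1) p.2 - hitT (a k p.1) p.2 : ℕ) : ℝ≥0∞) with hA
  set B : ℕ → Ω × (ℕ → ℤ) → ℝ≥0∞ := fun k p => (d (k + 1) p.1 : ℝ≥0∞) with hB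
  have hT_meas : ∀ k : ℤ, Measurable fun p : Ω × (ℕ → ℤ) => hitT (a k p.1) p.2 := by
    intro k
    have hh : Measurable fun z : ℤ × (ℕ → ℤ) => hitT z.1 z.2 :=
      measurable_from_prod_countable_right fun y => measurable_hitT y
    exact hh.comp (((ha_meas k).comp measurable_fst).prodMk measurable_snd)
  have hcast : Measurable fun n : ℕ => (n : ℝ≥0∞) := measurable_from_top
  have hAm : ∀ k, Measurable (A k) := fun k => hcast.comp ((hT_meas _).sub (hT_meas _))
  have hBm : ∀ k, Measurable (B k) := fun k => hcast.comp ((hd_meas _).comp measurable_fst)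
  have hAN : ∀ k N : ℕ, ∫⁻ p, min (A k p) N ∂(P ⊗ₘ K) = ∫⁻ ω, crossN N (Φ ω) ∂P := by
    intro k N
    rw [Measure.lintegral_compProd ((hAm k).min measurable_const),
      ← hinv k _ (measurable_crossN N)]
    refine lintegral_congr_ae ?_
    filter_upwards [h01, hgood_q] with ω hω hg
    rw [crossN_shf, hsite', hsite']
    exact lintegral_hit (envS_mem hω) (hK ω) hg (a k ω) (a ((k + 1 : ℕ) : ℤ) ω) (ha_nn ω k)
      (ha_mono ω k) N
  have hgapm : Measurable fun f : Sq => (gap f 0 : ℝ≥0∞) := hcast.comp (measurable_gap 0)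
  have hgs : ∀ (k : ℕ) ω, (d (k + 1) ω : ℝ≥0∞) = gap (shf ((k + 1 : ℕ) : ℤ) (Φ ω)) 0 := by
    intro k ω
    rw [← hgap]
    simp [gap, shf]
  have hBN : ∀ k N : ℕ, ∫⁻ p, min (B k p) N ∂(P ⊗ₘ K)
      = ∫⁻ ω, min (gap (Φ ω) 0 : ℝ≥0∞) N ∂P := by
    intro k N
    rw [Measure.lintegral_compProd ((hBm k).min measurable_const),
      ← hinv (k + 1) (fun f => min (gap f 0 : ℝ≥0∞) N) (hgapm.min measurable_const)]
    refine lintegral_congr fun ω => ?_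
    simp only [hB, lintegral_const, measure_univ, mul_one, hgs]
  have hAI : ∀ k, ∫⁻ p, A k p ∂(P ⊗ₘ K) = ∫⁻ ω, (⨆ N, crossN N (Φ ω)) ∂P := by
    intro k
    rw [lintegral_eq_iSup_min _ _ (hAm k) (fun _ => ENNReal.natCast_ne_top _)]
    simp only [hAN]
    have hc : ∀ N, Measurable fun ω => crossN N (Φ ω) := fun N => (measurable_crossN N).comp hΦ
    rw [lintegral_iSup hc]
    intro i j hij ω
    exact eN_mono _ _ _ _ hij
  have hBI : ∀ k, ∫⁻ p, B k p ∂(P ⊗ₘ K) = ∫⁻ ω, (d 0 ω : ℝ≥0∞) ∂P := by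
    intro k
    rw [lintegral_eq_iSup_min _ _ (hBm k) (fun _ => ENNReal.natCast_ne_top _)]
    simp only [hBN, hgap]
    have hc : Measurable fun ω => (d 0 ω : ℝ≥0∞) := hcast.comp (hd_meas 0)
    rw [← lintegral_eq_iSup_min _ _ hc (fun _ => ENNReal.natCast_ne_top _)]
  -- sums
  have hsumB : ∀ n p, ∑ k ∈ Finset.range n, B k p = ENNReal.ofReal (a n p.1 : ℝ) := by
    intro n p
    induction n with
    | zero => simp [ha0]
    | succ n ih =>
      rw [Finset.sum_range_succ, ih, ha_succ]
      push_cast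
      rw [ENNReal.ofReal_add (by exact_mod_cast ha_nn _ _) (by positivity),
        ENNReal.ofReal_natCast]
  have hsumA : ∀ n p, Good p.2 → ∑ k ∈ Finset.range n, A k p
      = ENNReal.ofReal (hitT (a n p.1) p.2 : ℝ) := by
    intro n p hp
    rw [ENNReal.ofReal_natCast]
    induction n with
    | zero => simp [ha0, hp.hitT_zero]
    | succ n ih =>
      rw [Finset.sum_range_succ, ih, hA]
      have := hp.hitT_mono (ha_nn p.1 n) (ha_mono p.1 n)
      rw [← Nat.cast_add]
      congr 1
      omega
  have hv0 : 0 < v := hv01.1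
  have hlim : ∀ᵐ p ∂(P ⊗ₘ K), Good p.2 ∧
      Tendsto (fun n : ℕ => (a n p.1 : ℝ) / (hitT (a n p.1) p.2 : ℝ)) atTop (𝓝 v) := by
    filter_upwards [hgood, hv] with p hp hpv
    exact ⟨hp, path_ratio hp hpv (fun n => a n p.1) (ha_ge p.1)⟩
  set m := ∫⁻ ω, (d 0 ω : ℝ≥0∞) ∂P with hm
  set s := ∫⁻ ω, (⨆ N, crossN N (Φ ω)) ∂P with hs
  have hpos : ∀ p : Ω × (ℕ → ℤ), Good p.2 → ∀ n : ℕ, 1 ≤ n →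
      0 < (a n p.1 : ℝ) ∧ 0 < (hitT (a n p.1) p.2 : ℝ) := by
    intro p hp n hn
    have h2 := ha_ge p.1 n
    have h3 := hp.le_hitT (ha_nn p.1 n)
    constructor
    · have : 0 < a n p.1 := by omega
      exact_mod_cast this
    · have : 0 < hitT (a n p.1) p.2 := by omega
      exact_mod_cast this
  have hup : s ≤ ENNReal.ofReal v⁻¹ * m := by
    refine le_limit hd_int _ fun c hc => ?_
    have hc0 : 0 < c := (inv_pos.2 hv0).trans hc
    have := compare_aux (P ⊗ₘ K) A B hAm hBm (fun k N => by rw [hAN, hAN])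
      (fun k => by rw [hBI, hBI]) (fun _ => ENNReal.natCast_ne_top _) (ENNReal.ofReal c) (by
        filter_upwards [hlim] with p hp
        have ht := hp.2.inv₀ hv0.ne'
        filter_upwards [ht.eventually_lt_const hc, eventually_ge_atTop 1] with n hn hn1
        obtain ⟨q1, q2⟩ := hpos p hp.1 n hn1
        rw [hsumA n p hp.1, hsumB, ← ENNReal.ofReal_mul hc0.le]
        apply ENNReal.ofReal_le_ofReal
        rw [inv_div, div_lt_iff₀ q1] at hn
        exact hn.le)
    rwa [hAI, hBI] at this
  have hs_top : s ≠ ⊤ := ne_top_of_le_ne_top (ENNReal.mul_ne_top ENNReal.ofReal_ne_top hd_int) hup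
  have hlow : m ≤ ENNReal.ofReal v * s := by
    refine le_limit hs_top _ fun c hc => ?_
    have hc0 : 0 < c := hv0.trans hc
    have := compare_aux (P ⊗ₘ K) B A hBm hAm (fun k N => by rw [hBN, hBN])
      (fun k => by rw [hAI, hAI]) (fun _ => ENNReal.natCast_ne_top _) (ENNReal.ofReal c) (by
        filter_upwards [hlim] with p hp
        filter_upwards [hp.2.eventually_lt_const hc, eventually_ge_atTop 1] with n hn hn1
        obtain ⟨q1, q2⟩ := hpos p hp.1 n hn1
        rw [hsumA n p hp.1, hsumB, ← ENNReal.ofReal_mul hc0.le]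
        apply ENNReal.ofReal_le_ofReal
        rw [div_lt_iff₀ q2] at hn
        exact hn.le)
    rwa [hAI, hBI] at this
  have hvE : ENNReal.ofReal v ≠ 0 := by simpa using hv0
  have hms : m = ENNReal.ofReal v * s := by
    refine le_antisymm hlow ?_
    calc ENNReal.ofReal v * s ≤ ENNReal.ofReal v * (ENNReal.ofReal v⁻¹ * m) := by gcongr
      _ = m := by
        rw [← mul_assoc, ← ENNReal.ofReal_mul hv0.le, mul_inv_cancel₀ hv0.ne', ENNReal.ofReal_one,
          one_mul]
  have hm0 : m ≠ 0 := by
    have : (1 : ℝ≥0∞) ≤ m := by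
      calc (1 : ℝ≥0∞) = ∫⁻ _, 1 ∂P := by simp
        _ ≤ m := lintegral_mono fun ω => by
          have := hd_pos 0 ω
          show (1 : ℝ≥0∞) ≤ (d 0 ω : ℝ≥0∞)
          exact_mod_cast this
    exact (zero_lt_one.trans_le this).ne'
  have hs0 : s ≠ 0 := by
    intro h; rw [h, mul_zero] at hms; exact hm0 hms
  -- the dual side
  have hdual : ∫⁻ ω, Stilde (rhoOf (sparseEnv (fun k => lam k ω)
      (fun k => a k ω + ⌊U ω * (d 0 ω : ℝ)⌋))) ∂(P.withDensity (fun ω => (d 0 ω : ℝ≥0∞) / m))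
      = m⁻¹ * s := by
    have hdm : Measurable fun ω => (d 0 ω : ℝ≥0∞) / m :=
      (hcast.comp (hd_meas 0)).div_const m
    have e1 : ∀ ω, Stilde (rhoOf (sparseEnv (fun k => lam k ω)
        (fun k => a k ω + ⌊U ω * (d 0 ω : ℝ)⌋)))
        = Sx (rhoOf (envS (Φ ω))) (-⌊U ω * (gap (Φ ω) 0 : ℝ)⌋) := by
      intro ω
      unfold Sx
      congr 1
      ext n
      have := sparseEnv_shift (fun k => lam k ω) (site_strictMono (Φ ω)).injective 0
        ⌊U ω * (d 0 ω : ℝ)⌋ n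
      simp only [add_zero, hsite'] at this
      rw [rhoOf, this, hgap, rhoOf, ← sub_eq_add_neg, envS]
    rw [lintegral_withDensity_eq_lintegral_mul_non_measurable _ hdm]
    swap
    · refine Eventually.of_forall fun ω => ?_
      exact ENNReal.div_lt_top (ENNReal.natCast_ne_top _) hm0
    have e2 : ∀ ω, ((fun ω => (d 0 ω : ℝ≥0∞) / m) * fun ω => Stilde (rhoOf (sparseEnv
        (fun k => lam k ω) (fun k => a k ω + ⌊U ω * (d 0 ω : ℝ)⌋)))) ω
        = m⁻¹ * ((gap (Φ ω) 0 : ℝ≥0∞) *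
          (fun i f => Sx (rhoOf (envS f)) (-i)) ⌊U ω * (gap (Φ ω) 0 : ℝ)⌋ (Φ ω)) := by
      intro ω
      rw [Pi.mul_apply, e1]
      simp only [hgap]
      rw [div_eq_mul_inv]
      ring
    rw [lintegral_congr e2, lintegral_const_mul' _ _ (ENNReal.inv_ne_top.2 hm0),
      lintegral_dual P U hU_meas Φ hΦ hU_law hU_indep (fun i f => Sx (rhoOf (envS f)) (-i))
        (fun i => measurable_Sx _), ← hL]
    rw [← cross_eq_dual h1 h01L, hL, lintegral_map (Measurable.iSup measurable_crossN) hΦ]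
  rw [hdual, ENNReal.mul_inv (Or.inr hs_top) (Or.inr hs0), inv_inv, hms, mul_assoc,
    ENNReal.mul_inv_cancel hs0 hs_top, mul_one]
end
end
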